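/- There exist constants ε₀ > 0 and C > 0 depending only on k such that the following holds. Let 0 < ε ≤ ε₀, let μ be an ε-product probability measure on V = V₁×⋯×V_k, let d ≤ k, let δ > 0, and let f : V → ℝ be (d,δ)-global. Then ‖f^{≤d}‖₄⁴ ≤ (100d)^d·δ²·‖f^{≤d}‖₂² + C·δ²·ε²·‖f‖₂². -/

import Mathlib

open Finset

namespace GLL

variable {k : ℕ} {V : Fin k → Type} [∀ i, Fintype (V i)] [∀ i, DecidableEq (V i)]

/-- Expectation of `f` with respect to the (finitely supported) measure `μ`. -/
def expect (μ f : (∀ i, V i) → ℝ) : ℝ := ∑ x, μ x * f x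

/-- `μ` is a probability measure. -/
def IsProb (μ : (∀ i, V i) → ℝ) : Prop := (∀ x, 0 ≤ μ x) ∧ ∑ x, μ x = 1

/-- The marginal `μ_S` evaluated at (the `S`-coordinates of) `x`. -/
def marg (μ : (∀ i, V i) → ℝ) (S : Finset (Fin k)) (x : ∀ i, V i) : ℝ :=
  ∑ z, if ∀ i ∈ S, z i = x i then μ z else 0

/-- The link (conditional) measure `μ_x` for `x ∈ V_S`, viewed as a measure on
full points agreeing with `x` on `S`. -/
noncomputable def cond (μ : (∀ i, V i) → ℝ) (S : Finset (Fin k)) (x z : ∀ i, V i) : ℝ :=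
  if ∀ i ∈ S, z i = x i then μ z / marg μ S x else 0

/-- The averaging operator `A_S`: `A_S f (x) = E_{y ∼ μ_{x_S}} [f(x_S, y)]`.
Applied to an `S'`-junta `f`, this is also the operator `A_{S',S}`. -/
noncomputable def Aop (μ : (∀ i, V i) → ℝ) (S : Finset (Fin k)) (f : (∀ i, V i) → ℝ)
    (x : ∀ i, V i) : ℝ :=
  ∑ z, cond μ S x z * f z

/-- The Efron–Stein component `f^{=S} = ∑_{T ⊆ S} (-1)^{|S∖T|} A_T f`. -/
noncomputable def ES (μ : (∀ i, V i) → ℝ) (S : Finset (Fin k)) (f : (∀ i, V i) → ℝ)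
    (x : ∀ i, V i) : ℝ :=
  ∑ T ∈ S.powerset, (-1 : ℝ) ^ (S.card - T.card) * Aop μ T f x

/-- The low-degree part `f^{≤ d} = ∑_{|S| ≤ d} f^{=S}`. -/
noncomputable def lowPart (μ : (∀ i, V i) → ℝ) (d : ℕ) (f : (∀ i, V i) → ℝ)
    (x : ∀ i, V i) : ℝ :=
  ∑ S ∈ univ.powerset.filter (fun S : Finset (Fin k) => S.card ≤ d), ES μ S f x

/-- The Laplacian `L_S[f] = ∑_{T ⊇ S} f^{=T}`. -/
noncomputable def Lap (μ : (∀ i, V i) → ℝ) (S : Finset (Fin k)) (f : (∀ i, V i) → ℝ)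
    (x : ∀ i, V i) : ℝ :=
  ∑ T ∈ univ.powerset.filter (fun T : Finset (Fin k) => S ⊆ T), ES μ T f x

/-- The truncated Laplacian `L_S^{≤d}[f] = ∑_{T ⊇ S, |T| ≤ d} f^{=T}`. -/
noncomputable def LapLe (μ : (∀ i, V i) → ℝ) (d : ℕ) (S : Finset (Fin k))
    (f : (∀ i, V i) → ℝ) (x : ∀ i, V i) : ℝ :=
  ∑ T ∈ univ.powerset.filter (fun T : Finset (Fin k) => S ⊆ T ∧ T.card ≤ d), ES μ T f x

/-- The influence `I_{S,x}[f] = ‖L_S[f](x,·)‖²_{L²(μ_x)}`. -/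
noncomputable def Inf (μ : (∀ i, V i) → ℝ) (S : Finset (Fin k)) (f : (∀ i, V i) → ℝ)
    (x : ∀ i, V i) : ℝ :=
  ∑ z, cond μ S x z * (Lap μ S f z) ^ 2

/-- The truncated influence `I^{≤d}_{S,x}[f] = ‖L_S^{≤d}[f](x,·)‖²_{L²(μ_x)}`. -/
noncomputable def InfLe (μ : (∀ i, V i) → ℝ) (d : ℕ) (S : Finset (Fin k))
    (f : (∀ i, V i) → ℝ) (x : ∀ i, V i) : ℝ :=
  ∑ z, cond μ S x z * (LapLe μ d S f z) ^ 2

/-- `‖f‖₂²` with respect to `μ`. -/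
def normSq (μ f : (∀ i, V i) → ℝ) : ℝ := ∑ x, μ x * (f x) ^ 2

/-- `‖f‖₄⁴` with respect to `μ`. -/
def norm4p4 (μ f : (∀ i, V i) → ℝ) : ℝ := ∑ x, μ x * (f x) ^ 4

/-- `‖f‖₂` with respect to `μ`. -/
noncomputable def l2norm (μ f : (∀ i, V i) → ℝ) : ℝ := Real.sqrt (normSq μ f)

/-- `‖f‖_∞`: the maximum of `|f|` over the support of `μ`. -/
noncomputable def supNorm (μ f : (∀ i, V i) → ℝ) : ℝ :=
  sSup ((fun x => |f x|) '' {x | 0 < μ x})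

/-- Inner product `⟨f, g⟩ = E_{x∼μ}[f(x) g(x)]`. -/
def inner' (μ f g : (∀ i, V i) → ℝ) : ℝ := ∑ x, μ x * (f x * g x)

/-- The pair `{i,j}`-skeleton of `μ` is `ε`-pseudorandom. -/
def PairPseudo (μ : (∀ i, V i) → ℝ) (ε : ℝ) (i j : Fin k) : Prop :=
  ∀ (f₁ : V i → ℝ) (f₂ : V j → ℝ),
    |expect μ (fun x => f₁ (x i) * f₂ (x j)) -
        expect μ (fun x => f₁ (x i)) * expect μ (fun x => f₂ (x j))| ≤
      ε * Real.sqrt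
        ((expect μ (fun x => f₁ (x i) ^ 2) - expect μ (fun x => f₁ (x i)) ^ 2) *
          (expect μ (fun x => f₂ (x j) ^ 2) - expect μ (fun x => f₂ (x j)) ^ 2))

/-- `μ` is an `ε`-product measure: every link of every restriction of size `≤ k - 2`
has `ε`-pseudorandom skeletons. -/
def EpsProduct (μ : (∀ i, V i) → ℝ) (ε : ℝ) : Prop :=
  ∀ S : Finset (Fin k), S.card ≤ k - 2 → ∀ x, 0 < marg μ S x →
    ∀ i j : Fin k, i ∉ S → j ∉ S → i ≠ j → PairPseudo (cond μ S x) ε i j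

/-- `‖f(x,·)‖_{L²(μ_x)}` for `x ∈ V_S`. -/
noncomputable def restrictNorm (μ : (∀ i, V i) → ℝ) (S : Finset (Fin k)) (x : ∀ i, V i)
    (f : (∀ i, V i) → ℝ) : ℝ :=
  Real.sqrt (∑ z, cond μ S x z * (f z) ^ 2)

/-- `f` is `(d, δ)`-global: all restrictions of at most `d` coordinates have
`2`-norm at most `δ`. -/
def IsGlobal (μ : (∀ i, V i) → ℝ) (d : ℕ) (δ : ℝ) (f : (∀ i, V i) → ℝ) : Prop :=
  ∀ S : Finset (Fin k), S.card ≤ d → ∀ x, 0 < marg μ S x → restrictNorm μ S x f ≤ δ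

/-- `f` is an `S`-junta: it depends only on the coordinates in `S`. -/
def Junta (S : Finset (Fin k)) (f : (∀ i, V i) → ℝ) : Prop :=
  ∀ x y, (∀ i ∈ S, x i = y i) → f x = f y

/-- The noise operator `T_ρ f = ∑_{S ⊆ [k]} ρ^{|S|} (1-ρ)^{k-|S|} A_S f`. -/
noncomputable def noiseOp (μ : (∀ i, V i) → ℝ) (ρ : ℝ) (f : (∀ i, V i) → ℝ)
    (x : ∀ i, V i) : ℝ :=
  ∑ S ∈ (univ : Finset (Fin k)).powerset, ρ ^ S.card * (1 - ρ) ^ (k - S.card) * Aop μ S f x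

/-- The up-down walk operator `T = (1/k) ∑_{i=1}^k A_{[k]∖{i}}`. -/
noncomputable def upDown (μ : (∀ i, V i) → ℝ) (f : (∀ i, V i) → ℝ) (x : ∀ i, V i) : ℝ :=
  (1 / (k : ℝ)) * ∑ i : Fin k, Aop μ (univ.erase i) f x

/-- The product measure `μ₁ ⊗ ⋯ ⊗ μ_k`. -/
def prodMeasure (μi : ∀ i, V i → ℝ) : (∀ i, V i) → ℝ := fun x => ∏ i, μi i (x i)

/-- `f` has degree at most `d`: `f^{=S} = 0` whenever `|S| > d`. -/
def DegLe (μ : (∀ i, V i) → ℝ) (d : ℕ) (f : (∀ i, V i) → ℝ) : Prop :=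
  ∀ S : Finset (Fin k), d < S.card → ∀ x, ES μ S f x = 0

/-- `{F S}_{S ⊆ [k]}` is an `(α, ε')`-approximate Efron–Stein decomposition of `f`. -/
noncomputable def ApproxES (μ : (∀ i, V i) → ℝ) (α ε' : ℝ) (f : (∀ i, V i) → ℝ)
    (F : Finset (Fin k) → (∀ i, V i) → ℝ) : Prop :=
  l2norm μ f ≤ α ∧
    l2norm μ (fun x => f x - ∑ S ∈ (univ : Finset (Fin k)).powerset, F S x) ≤ ε' ∧
    ∀ S : Finset (Fin k), ∃ h : (∀ i, V i) → ℝ,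
      l2norm μ h ≤ α ∧ l2norm μ (fun x => ES μ S h x - F S x) ≤ ε'

/-- The alternating sum `∑_{T ⊆ G} (-1)^{|G∖T|} φ(T)`. -/
def alt {ι E : Type*} [AddCommGroup E] [Module ℝ E] (φ : Finset ι → E) (G : Finset ι) : E :=
  ∑ T ∈ G.powerset, (-1 : ℝ) ^ (G.card - T.card) • φ T

section Alternating

variable {ι E : Type*} [AddCommGroup E] [Module ℝ E]

lemma alt_congr {φ ψ : Finset ι → E} {G : Finset ι} (h : ∀ T ⊆ G, φ T = ψ T) :
    alt φ G = alt ψ G :=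
  Finset.sum_congr rfl fun T hT => by rw [h T (Finset.mem_powerset.1 hT)]

lemma alt_sub (φ ψ : Finset ι → E) (G : Finset ι) :
    alt (fun T => φ T - ψ T) G = alt φ G - alt ψ G := by
  simp [alt, smul_sub]

lemma map_alt {E' : Type*} [AddCommGroup E'] [Module ℝ E'] (L : E →ₗ[ℝ] E')
    (φ : Finset ι → E) (G : Finset ι) : L (alt φ G) = alt (fun T => L (φ T)) G := by
  simp [alt]

variable [DecidableEq ι]

lemma alt_insert (φ : Finset ι → E) {i : ι} {G : Finset ι} (hi : i ∉ G) :
    alt φ (insert i G) = alt (fun T => φ (insert i T)) G - alt φ G := by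
  unfold alt
  rw [Finset.sum_powerset_insert hi, add_comm, sub_eq_add_neg, ← Finset.sum_neg_distrib]
  congr 1
  · refine Finset.sum_congr rfl fun T hT => ?_
    have hT' := Finset.mem_powerset.1 hT
    rw [Finset.card_insert_of_notMem hi, Finset.card_insert_of_notMem fun h => hi (hT' h)]
    simp
  · refine Finset.sum_congr rfl fun T hT => ?_
    have hc := Finset.card_le_card (Finset.mem_powerset.1 hT)
    rw [Finset.card_insert_of_notMem hi, Nat.succ_sub hc, pow_succ]
    simp

lemma alt_eq_zero {φ : Finset ι → E} {i : ι} {G : Finset ι} (hi : i ∈ G)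
    (h : ∀ T ⊆ G, φ (insert i T) = φ T) : alt φ G = 0 := by
  rw [← Finset.insert_erase hi, alt_insert φ (Finset.notMem_erase i G),
    alt_congr (ψ := φ) fun T hT => h T (hT.trans (Finset.erase_subset i G)), sub_self]

lemma sum_alt (φ : Finset ι → E) (P : Finset ι) : ∑ G ∈ P.powerset, alt φ G = φ P := by
  induction P using Finset.induction_on generalizing φ with
  | empty => simp [alt]
  | insert i P hi ih =>
    rw [Finset.sum_powerset_insert hi, ← Finset.sum_add_distrib, ← ih fun T => φ (insert i T)]
    refine Finset.sum_congr rfl fun G hG => ?_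
    rw [alt_insert φ fun h => hi (Finset.mem_powerset.1 hG h)]
    abel

lemma alt_union (φ : Finset ι → E) {D G : Finset ι} (h : Disjoint D G) :
    alt φ (D ∪ G) = alt (fun R => alt (fun T => φ (R ∪ T)) G) D := by
  induction D using Finset.induction_on generalizing φ with
  | empty => simp [alt]
  | insert i D hi ih =>
    rw [Finset.disjoint_insert_left] at h
    rw [Finset.insert_union, alt_insert φ (by simp [hi, h.1]), alt_insert _ hi, ih _ h.2, ih _ h.2]
    simp only [Finset.insert_union]

lemma alt_link_eq_sum (φ : Finset ι → E) {R G : Finset ι} (h : Disjoint R G) :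
    alt (fun T => φ (R ∪ T)) G = ∑ R' ∈ R.powerset, alt φ (R' ∪ G) := by
  rw [← sum_alt (fun R => alt (fun T => φ (R ∪ T)) G) R]
  refine Finset.sum_congr rfl fun R' hR => ?_
  rw [alt_union φ (Finset.disjoint_of_subset_left (Finset.mem_powerset.1 hR) h)]

end Alternating

/-- A finite weighted space with a family of conditional expectations `A S`, where `A S`
averages over the coordinates outside `S`. -/
structure CondSystem (ι Ω : Type*) [Fintype ι] [DecidableEq ι] [Fintype Ω] where
  w : Ω → ℝ
  w_nonneg : ∀ x, 0 ≤ w x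
  A : Finset ι → (Ω → ℝ) →ₗ[ℝ] (Ω → ℝ)
  A_univ : ∀ f, A univ f = f
  A_A_of_subset : ∀ {S T : Finset ι}, S ⊆ T → ∀ f, A S (A T f) = A S f
  A_A_of_superset : ∀ {S T : Finset ι}, S ⊆ T → ∀ f, A T (A S f) = A S f
  A_symm : ∀ S f g, ∑ x, w x * (A S f x * g x) = ∑ x, w x * (f x * A S g x)
  A_nonneg : ∀ S f, 0 ≤ f → 0 ≤ A S f
  A_one : ∀ S, A S 1 = 1
  A_mul : ∀ S f g, A S f = f → A S (f * g) = f * A S g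
  A_comp : ∀ S f (φ : ℝ → ℝ), A S f = f → A S (φ ∘ f) = φ ∘ f

namespace CondSystem

variable {ι Ω : Type*} [Fintype ι] [DecidableEq ι] [Fintype Ω] (M : CondSystem ι Ω)

/-- The inner product of `L²(w)`. -/
def ip (f g : Ω → ℝ) : ℝ := ∑ x, M.w x * (f x * g x)

/-- The norm of `L²(w)`. -/
noncomputable def nrm (f : Ω → ℝ) : ℝ := √(M.ip f f)

lemma ip_comm (f g : Ω → ℝ) : M.ip f g = M.ip g f := by simp only [ip, mul_comm (f _)]

lemma ip_add_left (f g h : Ω → ℝ) : M.ip (f + g) h = M.ip f h + M.ip g h := by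
  simp only [ip, Pi.add_apply, ← Finset.sum_add_distrib]
  exact Finset.sum_congr rfl fun _ _ => by ring

lemma ip_sub_left (f g h : Ω → ℝ) : M.ip (f - g) h = M.ip f h - M.ip g h := by
  simp only [ip, Pi.sub_apply, ← Finset.sum_sub_distrib]
  exact Finset.sum_congr rfl fun _ _ => by ring

lemma ip_smul_left (c : ℝ) (f h : Ω → ℝ) : M.ip (c • f) h = c * M.ip f h := by
  simp only [ip, Pi.smul_apply, Finset.mul_sum, smul_eq_mul]
  exact Finset.sum_congr rfl fun _ _ => by ring

lemma ip_sum_left {κ : Type*} (s : Finset κ) (f : κ → Ω → ℝ) (h : Ω → ℝ) :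
    M.ip (∑ i ∈ s, f i) h = ∑ i ∈ s, M.ip (f i) h := by
  simp only [ip, Finset.sum_apply, Finset.sum_mul, Finset.mul_sum]
  exact Finset.sum_comm

lemma ip_sum_right {κ : Type*} (s : Finset κ) (f : κ → Ω → ℝ) (h : Ω → ℝ) :
    M.ip h (∑ i ∈ s, f i) = ∑ i ∈ s, M.ip h (f i) := by
  simp only [M.ip_comm h, ip_sum_left]

lemma ip_self_nonneg (f : Ω → ℝ) : 0 ≤ M.ip f f :=
  Finset.sum_nonneg fun x _ => mul_nonneg (M.w_nonneg x) (mul_self_nonneg _)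

lemma ip_nonneg {f g : Ω → ℝ} (hf : 0 ≤ f) (hg : 0 ≤ g) : 0 ≤ M.ip f g :=
  Finset.sum_nonneg fun x _ => mul_nonneg (M.w_nonneg x) (mul_nonneg (hf x) (hg x))

lemma ip_mono_left {f f' g : Ω → ℝ} (h : f ≤ f') (hg : 0 ≤ g) : M.ip f g ≤ M.ip f' g :=
  Finset.sum_le_sum fun x _ =>
    mul_le_mul_of_nonneg_left (mul_le_mul_of_nonneg_right (h x) (hg x)) (M.w_nonneg x)

lemma ip_A (S : Finset ι) (f g : Ω → ℝ) : M.ip (M.A S f) g = M.ip f (M.A S g) := M.A_symm S f g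

lemma ip_A_A (S : Finset ι) (f g : Ω → ℝ) : M.ip (M.A S f) (M.A S g) = M.ip (M.A S f) g := by
  rw [← ip_A, M.A_A_of_subset subset_rfl]

lemma nrm_nonneg (f : Ω → ℝ) : 0 ≤ M.nrm f := Real.sqrt_nonneg _

lemma nrm_sq (f : Ω → ℝ) : M.nrm f ^ 2 = M.ip f f := Real.sq_sqrt (M.ip_self_nonneg f)

lemma nrm_zero : M.nrm 0 = 0 := by simp [nrm, ip]

lemma nrm_smul (c : ℝ) (f : Ω → ℝ) : M.nrm (c • f) = |c| * M.nrm f := by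
  unfold nrm
  rw [ip_smul_left, ip_comm, ip_smul_left, ← mul_assoc, Real.sqrt_mul (mul_self_nonneg c),
    Real.sqrt_mul_self_eq_abs]

lemma abs_ip_le (f g : Ω → ℝ) : |M.ip f g| ≤ M.nrm f * M.nrm g := by
  unfold nrm
  rw [← Real.sqrt_mul (M.ip_self_nonneg f)]
  refine Real.abs_le_sqrt ?_
  have h := Finset.sum_mul_sq_le_sq_mul_sq univ (fun x => √(M.w x) * f x)
    (fun x => √(M.w x) * g x)
  convert h using 2 <;> (try congr 1) <;> unfold ip
  all_goals
    refine Finset.sum_congr rfl fun x _ => ?_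
    have := Real.mul_self_sqrt (M.w_nonneg x)
    nth_rewrite 1 [← this]
    ring

lemma ip_le (f g : Ω → ℝ) : M.ip f g ≤ M.nrm f * M.nrm g := (le_abs_self _).trans (M.abs_ip_le f g)

lemma nrm_add_le (f g : Ω → ℝ) : M.nrm (f + g) ≤ M.nrm f + M.nrm g := by
  refine abs_le_of_sq_le_sq' ?_ (add_nonneg (M.nrm_nonneg f) (M.nrm_nonneg g)) |>.2
  rw [nrm_sq, ip_add_left, M.ip_comm f, M.ip_comm g, ip_add_left, ip_add_left, add_sq, nrm_sq,
    nrm_sq, M.ip_comm g f]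
  linarith [M.ip_le f g]

lemma nrm_sum_le {κ : Type*} (s : Finset κ) (f : κ → Ω → ℝ) :
    M.nrm (∑ i ∈ s, f i) ≤ ∑ i ∈ s, M.nrm (f i) :=
  Finset.le_sum_of_subadditive M.nrm M.nrm_zero.le M.nrm_add_le s f

lemma nrm_sum_sq_le {κ : Type*} (s : Finset κ) (f : κ → Ω → ℝ) :
    M.nrm (∑ i ∈ s, f i) ^ 2 ≤ s.card * ∑ i ∈ s, M.nrm (f i) ^ 2 :=
  (pow_le_pow_left₀ (M.nrm_nonneg _) (M.nrm_sum_le s f) 2).trans sq_sum_le_card_mul_sum_sq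

lemma nrm_add_sq_le (f g : Ω → ℝ) :
    M.nrm (f + g) ^ 2 ≤ 11 / 10 * M.nrm f ^ 2 + 11 * M.nrm g ^ 2 := by
  have := pow_le_pow_left₀ (M.nrm_nonneg _) (M.nrm_add_le f g) 2
  nlinarith [sq_nonneg (M.nrm f - 10 * M.nrm g)]

lemma nrm_mul_le {f g : Ω → ℝ} {c : ℝ} (hc : 0 ≤ c) (hf : ∀ x, |f x| ≤ c) :
    M.nrm (f * g) ≤ c * M.nrm g := by
  rw [← abs_of_nonneg hc, ← nrm_smul]
  refine Real.sqrt_le_sqrt (Finset.sum_le_sum fun x _ =>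
    mul_le_mul_of_nonneg_left ?_ (M.w_nonneg x))
  have : f x ^ 2 ≤ c ^ 2 := sq_le_sq' (abs_le.1 (hf x)).1 (abs_le.1 (hf x)).2
  simp only [Pi.mul_apply, Pi.smul_apply, smul_eq_mul]
  nlinarith [mul_le_mul_of_nonneg_right this (sq_nonneg (g x))]

lemma A_mono (S : Finset ι) {f g : Ω → ℝ} (h : f ≤ g) : M.A S f ≤ M.A S g := by
  have := M.A_nonneg S (g - f) (sub_nonneg.2 h)
  rwa [map_sub, sub_nonneg] at this

lemma A_idem (S : Finset ι) (f : Ω → ℝ) : M.A S (M.A S f) = M.A S f :=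
  M.A_A_of_subset subset_rfl f

/-- Conditional Cauchy–Schwarz. -/
lemma A_sum_mul_sq_le (S : Finset ι) {κ : Type*} (s : Finset κ) (a b : κ → Ω → ℝ) (x : Ω) :
    M.A S (∑ i ∈ s, a i * b i) x ^ 2 ≤
      M.A S (∑ i ∈ s, a i ^ 2) x * M.A S (∑ i ∈ s, b i ^ 2) x := by
  have key : ∀ t : ℝ, 0 ≤ M.A S (∑ i ∈ s, a i ^ 2) x * (t * t) +
      (2 * M.A S (∑ i ∈ s, a i * b i) x) * t + M.A S (∑ i ∈ s, b i ^ 2) x := by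
    intro t
    have h0 : (0 : Ω → ℝ) ≤ ∑ i ∈ s, (t • a i + b i) ^ 2 := 
      Finset.sum_nonneg fun i _ y => sq_nonneg ((t • a i + b i) y)
    have h1 : ∑ i ∈ s, (t • a i + b i) ^ 2 =
        (t * t) • ∑ i ∈ s, a i ^ 2 + (2 * t) • ∑ i ∈ s, a i * b i + ∑ i ∈ s, b i ^ 2 := by
      ext y
      simp only [Finset.sum_apply, Pi.add_apply, Pi.smul_apply, Pi.mul_apply, Pi.pow_apply,
        smul_eq_mul, Finset.mul_sum, ← Finset.sum_add_distrib]
      exact Finset.sum_congr rfl fun _ _ => by ring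
    have h2 := M.A_nonneg S _ h0 x
    rw [h1, map_add, map_add, map_smul, map_smul] at h2
    simp only [Pi.zero_apply, Pi.add_apply, Pi.smul_apply, smul_eq_mul] at h2
    linarith
  have := discrim_le_zero key
  rw [discrim] at this
  nlinarith

lemma A_sq_le (S : Finset ι) (f : Ω → ℝ) (x : Ω) : M.A S f x ^ 2 ≤ M.A S (f ^ 2) x := by
  have := M.A_sum_mul_sq_le S {()} (fun _ => f) (fun _ => 1) x
  simpa [M.A_one] using this

lemma nrm_A_le (S : Finset ι) (f : Ω → ℝ) : M.nrm (M.A S f) ≤ M.nrm f := by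
  by_cases h : M.nrm (M.A S f) = 0
  · rw [h]; exact M.nrm_nonneg f
  · have h1 : M.nrm (M.A S f) ^ 2 ≤ M.nrm (M.A S f) * M.nrm f := by
      rw [nrm_sq, ip_A_A]; exact M.ip_le _ _
    have h2 := lt_of_le_of_ne (M.nrm_nonneg (M.A S f)) (Ne.symm h)
    nlinarith

lemma A_mul_of_inv {S : Finset ι} {f g : Ω → ℝ} (hf : M.A S f = f) (hg : M.A S g = g) :
    M.A S (f * g) = f * g := by rw [M.A_mul S f g hf, hg]

end CondSystem

namespace CondSystem

section NumSub

variable {ι Ω : Type*} [Fintype ι]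

variable (ι) in
/-- The number of subsets of `ι`, as a real number. -/
noncomputable def numSub : ℝ := Fintype.card (Finset ι)

lemma one_le_numSub : 1 ≤ numSub ι := by
  unfold numSub; exact_mod_cast Fintype.card_pos

lemma numSub_nonneg : 0 ≤ numSub ι := zero_le_one.trans one_le_numSub

lemma card_le_numSub (s : Finset (Finset ι)) : (s.card : ℝ) ≤ numSub ι := by
  unfold numSub; exact_mod_cast Finset.card_le_univ s

lemma sum_le_numSub_mul (s : Finset (Finset ι)) {g : Finset ι → ℝ} {b : ℝ} (hb : 0 ≤ b)
    (h : ∀ T ∈ s, g T ≤ b) : ∑ T ∈ s, g T ≤ numSub ι * b := by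
  refine (Finset.sum_le_card_nsmul s g b h).trans ?_
  rw [nsmul_eq_mul]
  exact mul_le_mul_of_nonneg_right (card_le_numSub s) hb

lemma abs_alt_le {φ : Finset ι → Ω → ℝ} {G : Finset ι} {b : ℝ} (hb : 0 ≤ b) (x : Ω)
    (h : ∀ T ⊆ G, |φ T x| ≤ b) : |alt φ G x| ≤ numSub ι * b := by
  unfold alt
  rw [Finset.sum_apply]
  refine (Finset.abs_sum_le_sum_abs _ _).trans (sum_le_numSub_mul _ hb fun T hT => ?_)
  rw [Pi.smul_apply, smul_eq_mul, abs_mul, abs_pow, abs_neg, abs_one, one_pow, one_mul]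
  exact h T (Finset.mem_powerset.1 hT)

lemma four_pow_card_le (S : Finset ι) : (4 : ℝ) ^ S.card ≤ numSub ι ^ 2 := by
  have h := card_le_numSub S.powerset
  rw [Finset.card_powerset] at h
  push_cast at h
  calc (4 : ℝ) ^ S.card = (2 ^ S.card) ^ 2 := by rw [← pow_mul, mul_comm, pow_mul]; norm_num
    _ ≤ _ := by gcongr

lemma three_pow_card_le (S : Finset ι) : (3 : ℝ) ^ S.card ≤ numSub ι ^ 2 :=
  (pow_le_pow_left₀ (by norm_num) (by norm_num) _).trans (four_pow_card_le S)

end NumSub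

variable {ι Ω : Type*} [Fintype ι] [DecidableEq ι] [Fintype Ω] (M : CondSystem ι Ω)

/-- The Efron–Stein projection to the component `G` inside the links of the coordinates `R`. -/
noncomputable def Z (R G : Finset ι) : (Ω → ℝ) →ₗ[ℝ] (Ω → ℝ) := alt (fun T => M.A (R ∪ T)) G

/-- Compositions of averaging operators are `η`-close to averaging over the intersection. -/
def AlmostCommute (η : ℝ) : Prop :=
  ∀ T U f, M.nrm (M.A T (M.A U f) - M.A (T ∩ U) f) ≤ η * M.nrm f

lemma Z_apply (R G : Finset ι) (f : Ω → ℝ) : M.Z R G f = alt (fun T => M.A (R ∪ T) f) G :=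
  map_alt (LinearMap.applyₗ f) (fun T => M.A (R ∪ T)) G

lemma nrm_alt_le {φ : Finset ι → Ω → ℝ} {G : Finset ι} {b : ℝ} (hb : 0 ≤ b)
    (h : ∀ T ⊆ G, M.nrm (φ T) ≤ b) : M.nrm (alt φ G) ≤ numSub ι * b := by
  refine (M.nrm_sum_le _ _).trans (sum_le_numSub_mul _ hb fun T hT => ?_)
  rw [nrm_smul, abs_pow, abs_neg, abs_one, one_pow, one_mul]
  exact h T (Finset.mem_powerset.1 hT)

lemma nrm_Z_le (R G : Finset ι) (f : Ω → ℝ) : M.nrm (M.Z R G f) ≤ numSub ι * M.nrm f := by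
  rw [Z_apply]
  exact M.nrm_alt_le (M.nrm_nonneg f) fun T _ => M.nrm_A_le _ f

lemma A_Z_of_subset {R G U : Finset ι} (h : R ∪ G ⊆ U) (f : Ω → ℝ) :
    M.A U (M.Z R G f) = M.Z R G f := by
  rw [Z_apply, map_alt]
  exact alt_congr fun T hT =>
    M.A_A_of_superset ((Finset.union_subset_union_right hT).trans h) f

lemma Z_empty_A {S T : Finset ι} (h : S ⊆ T) (f : Ω → ℝ) : M.Z ∅ S (M.A T f) = M.Z ∅ S f := by
  rw [Z_apply, Z_apply]
  exact alt_congr fun U hU => M.A_A_of_subset (by simpa using hU.trans h) f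

lemma sum_Z (R : Finset ι) (f : Ω → ℝ) : ∑ G ∈ Rᶜ.powerset, M.Z R G f = f := by
  simp only [Z_apply]
  rw [sum_alt (fun T => M.A (R ∪ T) f), Finset.union_compl, M.A_univ]

lemma sum_Z_empty (f : Ω → ℝ) : ∑ S, M.Z ∅ S f = f := by
  simpa [Finset.powerset_univ] using M.sum_Z ∅ f

lemma Z_eq_sum {R G : Finset ι} (h : Disjoint R G) (f : Ω → ℝ) :
    M.Z R G f = ∑ R' ∈ R.powerset, M.Z ∅ (R' ∪ G) f := by
  simp only [Z_apply, Finset.empty_union]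
  exact alt_link_eq_sum (fun T => M.A T f) h

lemma Z_empty_union {D G : Finset ι} (h : Disjoint D G) (f : Ω → ℝ) :
    M.Z ∅ (D ∪ G) f = alt (fun R => M.Z R G f) D := by
  simp only [Z_apply, Finset.empty_union]
  exact alt_union (fun T => M.A T f) h

variable {M} {η : ℝ}

lemma AlmostCommute.nrm_A_Z_le (hM : M.AlmostCommute η) (hη : 0 ≤ η) {R G U : Finset ι} {i : ι}
    (hG : i ∈ G) (hU : i ∉ U) (f : Ω → ℝ) :
    M.nrm (M.A U (M.Z R G f)) ≤ numSub ι * (η * M.nrm f) := by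
  have h0 : alt (fun T => M.A (U ∩ (R ∪ T)) f) G = 0 := by
    refine alt_eq_zero hG fun T _ => ?_
    rw [Finset.union_insert, Finset.inter_insert_of_notMem hU]
  have h1 : M.A U (M.Z R G f) =
      alt (fun T => M.A U (M.A (R ∪ T) f) - M.A (U ∩ (R ∪ T)) f) G := by
    rw [alt_sub, h0, sub_zero, Z_apply, map_alt]
  rw [h1]
  exact M.nrm_alt_le (mul_nonneg hη (M.nrm_nonneg f)) fun T _ => hM _ _ f

lemma AlmostCommute.nrm_Z_A_le (hM : M.AlmostCommute η) (hη : 0 ≤ η) {S W : Finset ι}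
    (h : ¬ S ⊆ W) (f : Ω → ℝ) : M.nrm (M.Z ∅ S (M.A W f)) ≤ numSub ι * (η * M.nrm f) := by
  obtain ⟨i, hS, hW⟩ := Finset.not_subset.1 h
  have h0 : alt (fun T => M.A (T ∩ W) f) S = 0 := by
    refine alt_eq_zero hS fun T _ => ?_
    rw [Finset.insert_inter_of_notMem hW]
  have h1 : M.Z ∅ S (M.A W f) = alt (fun T => M.A T (M.A W f) - M.A (T ∩ W) f) S := by
    rw [alt_sub, h0, sub_zero, Z_apply]
    simp
  rw [h1]
  exact M.nrm_alt_le (mul_nonneg hη (M.nrm_nonneg f)) fun T _ => hM _ _ f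

lemma AlmostCommute.nrm_Z_Z_le (hM : M.AlmostCommute η) (hη : 0 ≤ η) {S T : Finset ι}
    (h : S ≠ T) (f : Ω → ℝ) :
    M.nrm (M.Z ∅ S (M.Z ∅ T f)) ≤ numSub ι * (numSub ι * (η * M.nrm f)) := by
  have hb : 0 ≤ numSub ι * (η * M.nrm f) :=
    mul_nonneg numSub_nonneg (mul_nonneg hη (M.nrm_nonneg f))
  by_cases hTS : T ⊆ S
  · have hST : ¬ S ⊆ T := fun h' => h (h'.antisymm hTS)
    rw [Z_apply _ _ T, map_alt]
    refine M.nrm_alt_le hb fun W hW => hM.nrm_Z_A_le hη (fun h' => hST (h'.trans ?_)) f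
    simpa using hW
  · obtain ⟨i, hT, hS⟩ := Finset.not_subset.1 hTS
    rw [Z_apply _ _ S]
    refine M.nrm_alt_le hb fun U hU => hM.nrm_A_Z_le hη hT (fun h' => hS (hU ?_)) f
    simpa using h'

lemma AlmostCommute.abs_ip_Z_Z_le (hM : M.AlmostCommute η) (hη : 0 ≤ η) {R G G' : Finset ι}
    (hG : Disjoint R G) (hG' : Disjoint R G') (h : G ≠ G') (f : Ω → ℝ) :
    |M.ip (M.Z R G f) (M.Z R G' f)| ≤ numSub ι * (numSub ι * (η * M.nrm f)) * M.nrm f := by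
  wlog hsub : ¬ G ⊆ G' generalizing G G'
  · rw [ip_comm]
    exact this hG' hG h.symm fun h' => h ((not_not.1 hsub).antisymm h')
  obtain ⟨i, hi, hi'⟩ := Finset.not_subset.1 hsub
  have h1 : M.ip (M.Z R G f) (M.Z R G' f) =
      M.ip (alt (fun T => M.A (R ∪ T) (M.Z R G f)) G') f := by
    rw [Z_apply _ _ G']
    simp only [alt, ip_sum_left, ip_sum_right, ip_smul_left, ip_A]
    exact Finset.sum_congr rfl fun T _ => by rw [ip_comm, ip_smul_left, ip_comm]
  rw [h1]
  refine (M.abs_ip_le _ _).trans (mul_le_mul_of_nonneg_right ?_ (M.nrm_nonneg f))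
  refine M.nrm_alt_le (mul_nonneg numSub_nonneg (mul_nonneg hη (M.nrm_nonneg f))) fun T hT =>
    hM.nrm_A_Z_le hη hi (fun h' => ?_) f
  rcases Finset.mem_union.1 h' with h' | h'
  · exact Finset.disjoint_left.1 hG h' hi
  · exact hi' (hT h')

/-- Approximate Parseval identity in the links of the coordinates `R`. -/
lemma AlmostCommute.abs_parseval (hM : M.AlmostCommute η) (hη : 0 ≤ η) (R : Finset ι)
    (f : Ω → ℝ) :
    |M.nrm f ^ 2 - ∑ G ∈ Rᶜ.powerset, M.nrm (M.Z R G f) ^ 2| ≤ numSub ι ^ 4 * η * M.nrm f ^ 2 := by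
  have hd : ∀ G ∈ Rᶜ.powerset, Disjoint R G := fun G hG =>
    (Finset.subset_compl_iff_disjoint_left.1 (Finset.mem_powerset.1 hG))
  have h1 : M.nrm f ^ 2 - ∑ G ∈ Rᶜ.powerset, M.nrm (M.Z R G f) ^ 2 =
      ∑ G ∈ Rᶜ.powerset, ∑ G' ∈ Rᶜ.powerset.erase G, M.ip (M.Z R G f) (M.Z R G' f) := by
    rw [nrm_sq]
    nth_rewrite 1 2 [← M.sum_Z R f]
    rw [ip_sum_left, ← Finset.sum_sub_distrib]
    refine Finset.sum_congr rfl fun G hG => ?_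
    rw [ip_sum_right, nrm_sq, ← Finset.add_sum_erase _ _ hG]
    ring
  have hn : (0 : ℝ) ≤ numSub ι := numSub_nonneg
  have hb : 0 ≤ numSub ι * (numSub ι * (η * M.nrm f)) * M.nrm f := by
    have := M.nrm_nonneg f
    positivity
  rw [h1]
  calc _ ≤ ∑ G ∈ Rᶜ.powerset, ∑ G' ∈ Rᶜ.powerset.erase G, |M.ip (M.Z R G f) (M.Z R G' f)| :=
        (Finset.abs_sum_le_sum_abs _ _).trans
          (Finset.sum_le_sum fun G _ => Finset.abs_sum_le_sum_abs _ _)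
    _ ≤ numSub ι * (numSub ι * (numSub ι * (numSub ι * (η * M.nrm f)) * M.nrm f)) := by
        refine sum_le_numSub_mul _ (mul_nonneg hn hb) fun G hG =>
          sum_le_numSub_mul _ hb fun G' hG' => ?_
        obtain ⟨hne, hG'⟩ := Finset.mem_erase.1 hG'
        exact hM.abs_ip_Z_Z_le hη (hd G hG) (hd G' hG') hne.symm f
    _ = _ := by ring

lemma AlmostCommute.sum_nrm_Z_sq_le (hM : M.AlmostCommute η) (hη : 0 ≤ η) (R : Finset ι)
    (f : Ω → ℝ) :
    ∑ G ∈ Rᶜ.powerset, M.nrm (M.Z R G f) ^ 2 ≤ (1 + numSub ι ^ 4 * η) * M.nrm f ^ 2 := by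
  have := (abs_le.1 (hM.abs_parseval hη R f)).1
  linarith

lemma AlmostCommute.nrm_sq_le (hM : M.AlmostCommute η) (hη : 0 ≤ η) (f : Ω → ℝ) :
    M.nrm f ^ 2 ≤ ∑ S, M.nrm (M.Z ∅ S f) ^ 2 + numSub ι ^ 4 * η * M.nrm f ^ 2 := by
  have := (abs_le.1 (hM.abs_parseval hη ∅ f)).2
  simp only [Finset.compl_empty, Finset.powerset_univ] at this
  linarith

lemma AlmostCommute.nrm_Z_empty_sq_le (hM : M.AlmostCommute η) (hη : 0 ≤ η) (S : Finset ι)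
    (f : Ω → ℝ) : M.nrm (M.Z ∅ S f) ^ 2 ≤ (1 + numSub ι ^ 4 * η) * M.nrm (M.A S f) ^ 2 := by
  rw [← M.Z_empty_A subset_rfl f]
  refine le_trans ?_ (hM.sum_nrm_Z_sq_le hη ∅ (M.A S f))
  exact Finset.single_le_sum (f := fun S' => M.nrm (M.Z ∅ S' (M.A S f)) ^ 2)
    (fun _ _ => sq_nonneg _) (by simp)

end CondSystem

lemma card_pairs_union_eq_le {ι : Type*} [Fintype ι] [DecidableEq ι] (T : Finset ι) :
    ((univ.filter fun p : Finset ι × Finset ι => p.1 ∪ p.2 = T).card : ℝ) ≤ 3 ^ T.card := by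
  have h1 : (univ.filter fun p : Finset ι × Finset ι => p.1 ∪ p.2 = T) ⊆
      T.powerset.biUnion fun P => P.powerset.image fun Q => (P, Q ∪ T \ P) := by
    rintro ⟨P, Q⟩ h
    simp only [Finset.mem_filter, Finset.mem_univ, true_and] at h
    simp only [Finset.mem_biUnion, Finset.mem_powerset, Finset.mem_image, Prod.mk.injEq]
    refine ⟨P, h ▸ Finset.subset_union_left, Q ∩ P, Finset.inter_subset_right, rfl, ?_⟩
    subst h
    ext i
    simp only [Finset.mem_union, Finset.mem_inter, Finset.mem_sdiff]
    tauto
  calc _ ≤ ∑ P ∈ T.powerset, (2 : ℝ) ^ P.card * 1 ^ (T.card - P.card) := by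
        refine (Nat.cast_le.2 ((Finset.card_le_card h1).trans Finset.card_biUnion_le)).trans ?_
        rw [Nat.cast_sum]
        refine Finset.sum_le_sum fun P _ => ?_
        rw [one_pow, mul_one]
        exact_mod_cast Finset.card_image_le.trans (Finset.card_powerset P).le
    _ = 3 ^ T.card := by rw [Finset.sum_pow_mul_eq_add_pow]; norm_num

/-- Pairs of sets that agree outside `T` and cover `T` correspond to triples `(P, Q, E)` with
`P ∪ Q = T` and `E` disjoint from `T`. -/
lemma sum_pairs_eq {ι E' : Type*} [Fintype ι] [DecidableEq ι] [AddCommMonoid E']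
    (T : Finset ι) (φ : Finset ι → Finset ι → E') :
    ∑ p : Finset ι × Finset ι with p.1 \ T = p.2 \ T ∧ T ⊆ p.1 ∪ p.2, φ p.1 p.2 =
      ∑ p : Finset ι × Finset ι with p.1 ∪ p.2 = T,
        ∑ E ∈ (p.1 ∪ p.2)ᶜ.powerset, φ (p.1 ∪ E) (p.2 ∪ E) := by
  rw [Finset.sum_sigma']
  refine Finset.sum_bij' (fun p _ => ⟨(p.1 ∩ T, p.2 ∩ T), p.1 \ T⟩)
    (fun q _ => (q.1.1 ∪ q.2, q.1.2 ∪ q.2)) ?_ ?_ ?_ ?_ ?_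
  · rintro ⟨S₁, S₂⟩ h
    simp only [Finset.mem_filter, Finset.mem_univ, true_and] at h
    have hT : S₁ ∩ T ∪ S₂ ∩ T = T := by
      rw [← Finset.union_inter_distrib_right]; exact Finset.inter_eq_right.2 h.2
    simp only [Finset.mem_sigma, Finset.mem_filter, Finset.mem_univ, true_and,
      Finset.mem_powerset, hT]
    intro i hi
    simp only [Finset.mem_sdiff] at hi
    simpa using hi.2
  · rintro ⟨⟨P, Q⟩, E⟩ h
    simp only [Finset.mem_sigma, Finset.mem_filter, Finset.mem_univ, true_and,
      Finset.mem_powerset] at h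
    obtain ⟨h, hE⟩ := h
    subst h
    simp only [Finset.mem_filter, Finset.mem_univ, true_and]
    refine ⟨?_, ?_⟩
    · ext i; simp only [Finset.mem_sdiff, Finset.mem_union]; tauto
    · intro i; simp only [Finset.mem_union]; tauto
  · rintro ⟨S₁, S₂⟩ h
    simp only [Finset.mem_filter, Finset.mem_univ, true_and] at h
    simp only [Prod.mk.injEq]
    constructor
    · rw [Finset.union_comm, Finset.sdiff_union_inter]
    · rw [h.1, Finset.union_comm, Finset.sdiff_union_inter]
  · rintro ⟨⟨P, Q⟩, E⟩ h
    simp only [Finset.mem_sigma, Finset.mem_filter, Finset.mem_univ, true_and,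
      Finset.mem_powerset] at h
    obtain ⟨h, hE⟩ := h
    subst h
    have hE' : ∀ i ∈ E, i ∉ P ∧ i ∉ Q := fun i hi => by simpa using hE hi
    have e1 : (P ∪ E) ∩ (P ∪ Q) = P := by
      ext i; simp only [Finset.mem_inter, Finset.mem_union]; have := hE' i; tauto
    have e2 : (Q ∪ E) ∩ (P ∪ Q) = Q := by
      ext i; simp only [Finset.mem_inter, Finset.mem_union]; have := hE' i; tauto
    have e3 : (P ∪ E) \ (P ∪ Q) = E := by
      ext i; simp only [Finset.mem_sdiff, Finset.mem_union]; have := hE' i; tauto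
    simp only [e1, e2, e3]
  · rintro ⟨S₁, S₂⟩ h
    simp only [Finset.mem_filter, Finset.mem_univ, true_and] at h
    dsimp only
    rw [Finset.union_comm, Finset.sdiff_union_inter, h.1, Finset.union_comm,
      Finset.sdiff_union_inter]

namespace CondSystem

variable {ι Ω : Type*} [Fintype ι] [DecidableEq ι] [Fintype Ω] (M : CondSystem ι Ω)

/-- The Efron–Stein component of `f` at `S`, set to zero if `|S| > d`. -/
noncomputable def lowComp (d : ℕ) (f : Ω → ℝ) (S : Finset ι) : Ω → ℝ :=
  if S.card ≤ d then M.Z ∅ S f else 0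

/-- The total squared norm of the components of degree at most `d`. -/
noncomputable def energy (d : ℕ) (f : Ω → ℝ) : ℝ := ∑ S, M.nrm (M.lowComp d f S) ^ 2

/-- All averages of `f ^ 2` over at least all but `d` coordinates are at most `δ ^ 2`. -/
def Global (d : ℕ) (δ : ℝ) (f : Ω → ℝ) : Prop :=
  ∀ R : Finset ι, R.card ≤ d → ∀ x, M.A R (f ^ 2) x ≤ δ ^ 2

variable {M} {η δ : ℝ} {d : ℕ} {f : Ω → ℝ}

lemma energy_nonneg : 0 ≤ M.energy d f := Finset.sum_nonneg fun _ _ => sq_nonneg _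

lemma nrm_lowComp_sq_le_energy (S : Finset ι) : M.nrm (M.lowComp d f S) ^ 2 ≤ M.energy d f :=
  Finset.single_le_sum (f := fun S => M.nrm (M.lowComp d f S) ^ 2) (fun _ _ => sq_nonneg _)
    (Finset.mem_univ S)

lemma nrm_lowComp_le_sqrt (S : Finset ι) : M.nrm (M.lowComp d f S) ≤ √(M.energy d f) :=
  Real.le_sqrt_of_sq_le (nrm_lowComp_sq_le_energy S)

lemma Global.abs_A_le (hf : M.Global d δ f) (hδ : 0 ≤ δ) {R : Finset ι} (hR : R.card ≤ d)
    (x : Ω) : |M.A R f x| ≤ δ :=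
  abs_le_of_sq_le_sq ((M.A_sq_le R f x).trans (hf R hR x)) hδ

lemma Global.abs_Z_le (hf : M.Global d δ f) (hδ : 0 ≤ δ) {R G : Finset ι}
    (h : (R ∪ G).card ≤ d) (x : Ω) : |M.Z R G f x| ≤ numSub ι * δ := by
  rw [Z_apply]
  exact abs_alt_le hδ x fun T hT =>
    hf.abs_A_le hδ ((Finset.card_le_card (Finset.union_subset_union_right hT)).trans h) x

lemma Global.abs_lowComp_le (hf : M.Global d δ f) (hδ : 0 ≤ δ) (S : Finset ι) (x : Ω) :
    |M.lowComp d f S x| ≤ numSub ι * δ := by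
  unfold lowComp
  split_ifs with h
  · exact hf.abs_Z_le hδ (by simpa using h) x
  · simpa using mul_nonneg numSub_nonneg hδ

lemma Global.nrm_lowComp_sq_le (hf : M.Global d δ f) (hδ : 0 ≤ δ) (S : Finset ι) :
    M.nrm (M.lowComp d f S ^ 2) ≤ numSub ι * δ * √(M.energy d f) := by
  rw [sq]
  exact (M.nrm_mul_le (mul_nonneg numSub_nonneg hδ) (hf.abs_lowComp_le hδ S)).trans
    (mul_le_mul_of_nonneg_left (nrm_lowComp_le_sqrt S) (mul_nonneg numSub_nonneg hδ))

lemma nrm_lowComp_le (S : Finset ι) : M.nrm (M.lowComp d f S) ≤ numSub ι * M.nrm f := by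
  unfold lowComp
  split_ifs
  · exact M.nrm_Z_le ∅ S f
  · rw [nrm_zero]; exact mul_nonneg numSub_nonneg (M.nrm_nonneg f)

lemma A_lowComp {S U : Finset ι} (h : S ⊆ U) :
    M.A U (M.lowComp d f S) = M.lowComp d f S := by
  unfold lowComp
  split_ifs
  · exact M.A_Z_of_subset (by simpa using h) f
  · simp

lemma A_lowComp_sq {S U : Finset ι} (h : S ⊆ U) :
    M.A U (M.lowComp d f S ^ 2) = M.lowComp d f S ^ 2 := by
  rw [sq]; exact M.A_mul_of_inv (A_lowComp h) (A_lowComp h)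

lemma AlmostCommute.nrm_A_lowComp_le (hM : M.AlmostCommute η) (hη : 0 ≤ η) {S U : Finset ι}
    {i : ι} (hS : i ∈ S) (hU : i ∉ U) :
    M.nrm (M.A U (M.lowComp d f S)) ≤ numSub ι * (η * M.nrm f) := by
  unfold lowComp
  split_ifs
  · exact hM.nrm_A_Z_le hη hS hU f
  · rw [map_zero, nrm_zero]
    exact mul_nonneg numSub_nonneg (mul_nonneg hη (M.nrm_nonneg f))

lemma AlmostCommute.energy_le (hM : M.AlmostCommute η) (hη : 0 ≤ η) :
    M.energy d f ≤ 11 / 10 * ((1 + numSub ι ^ 4 * η) * M.nrm (∑ S, M.lowComp d f S) ^ 2) +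
      11 * numSub ι ^ 7 * η ^ 2 * M.nrm f ^ 2 := by
  set g := ∑ S, M.lowComp d f S with hg
  have hn : 0 ≤ numSub ι := numSub_nonneg
  have hnf := M.nrm_nonneg f
  have hb : 0 ≤ numSub ι * (numSub ι * (η * M.nrm f)) := by positivity
  have hdiff : ∀ S : Finset ι, S.card ≤ d →
      M.nrm (M.lowComp d f S - M.Z ∅ S g) ≤
        numSub ι * (numSub ι * (numSub ι * (η * M.nrm f))) := by
    intro S hS
    have h1 : M.lowComp d f S - M.Z ∅ S g = ∑ T, M.Z ∅ S (M.Z ∅ T f - M.lowComp d f T) := by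
      rw [lowComp, if_pos hS, ← map_sum, Finset.sum_sub_distrib, sum_Z_empty, map_sub]
    rw [h1]
    refine (M.nrm_sum_le _ _).trans (sum_le_numSub_mul _ hb fun T _ => ?_)
    unfold lowComp
    split_ifs with hT
    · rw [sub_self, map_zero, nrm_zero]; exact hb
    · rw [sub_zero]
      exact hM.nrm_Z_Z_le hη (by rintro rfl; exact hT hS) f
  have hterm : ∀ S : Finset ι, M.nrm (M.lowComp d f S) ^ 2 ≤
      11 / 10 * M.nrm (M.Z ∅ S g) ^ 2 + 11 * (numSub ι ^ 6 * η ^ 2 * M.nrm f ^ 2) := by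
    intro S
    by_cases hS : S.card ≤ d
    · have h2 := M.nrm_add_sq_le (M.Z ∅ S g) (M.lowComp d f S - M.Z ∅ S g)
      rw [add_sub_cancel] at h2
      have h3 := pow_le_pow_left₀ (M.nrm_nonneg _) (hdiff S hS) 2
      have h4 : (numSub ι * (numSub ι * (numSub ι * (η * M.nrm f)))) ^ 2 =
        numSub ι ^ 6 * η ^ 2 * M.nrm f ^ 2 := by ring
      linarith
    · rw [lowComp, if_neg hS, nrm_zero, zero_pow two_ne_zero]
      have := sq_nonneg (M.nrm (M.Z ∅ S g))
      positivity
  have hsum := hM.sum_nrm_Z_sq_le hη ∅ g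
  simp only [Finset.compl_empty, Finset.powerset_univ] at hsum
  calc M.energy d f ≤ ∑ S : Finset ι, (11 / 10 * M.nrm (M.Z ∅ S g) ^ 2 +
        11 * (numSub ι ^ 6 * η ^ 2 * M.nrm f ^ 2)) := Finset.sum_le_sum fun S _ => hterm S
    _ ≤ 11 / 10 * ((1 + numSub ι ^ 4 * η) * M.nrm g ^ 2) +
        numSub ι * (11 * (numSub ι ^ 6 * η ^ 2 * M.nrm f ^ 2)) := by
        rw [Finset.sum_add_distrib, ← Finset.mul_sum]
        gcongr
        exact sum_le_numSub_mul _ (by positivity) fun _ _ => le_rfl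
    _ = _ := by ring

/-- Components of the product of two low degree components at sets violating the product-space
support constraints are negligible. -/
lemma Global.nrm_Z_mul_le (hf : M.Global d δ f) (hM : M.AlmostCommute η) (hη : 0 ≤ η)
    (hδ : 0 ≤ δ) {T S₁ S₂ : Finset ι} (h : ¬ (S₁ \ T = S₂ \ T ∧ T ⊆ S₁ ∪ S₂)) :
    M.nrm (M.Z ∅ T (M.lowComp d f S₁ * M.lowComp d f S₂)) ≤
      numSub ι ^ 3 * η * δ * M.nrm f := by
  have hn : 0 ≤ numSub ι := numSub_nonneg
  have hnf := M.nrm_nonneg f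
  by_cases hT : T ⊆ S₁ ∪ S₂
  · have hne : S₁ \ T ≠ S₂ \ T := fun h' => h ⟨h', hT⟩
    wlog hex : ∃ i ∈ S₁ \ T, i ∉ S₂ \ T generalizing S₁ S₂
    · rw [mul_comm]
      refine this (fun h' => h ⟨h'.1.symm, hT⟩) (by rwa [Finset.union_comm]) hne.symm ?_
      by_contra hno
      push Not at hex hno
      exact hne (Finset.Subset.antisymm hex hno)
    obtain ⟨i, hi1, hi2⟩ := hex
    rw [Finset.mem_sdiff] at hi1 hi2
    have hi2' : i ∉ S₂ := fun h' => hi2 ⟨h', hi1.2⟩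
    have key : M.nrm (M.A (univ.erase i) (M.lowComp d f S₁ * M.lowComp d f S₂)) ≤
        numSub ι * δ * (numSub ι * (η * M.nrm f)) := by
      rw [mul_comm, M.A_mul _ _ _ (A_lowComp fun j hj => by
        simp only [Finset.mem_erase, Finset.mem_univ, and_true]; rintro rfl; exact hi2' hj)]
      exact (M.nrm_mul_le (mul_nonneg hn hδ) (hf.abs_lowComp_le hδ S₂)).trans
        (mul_le_mul_of_nonneg_left (hM.nrm_A_lowComp_le hη hi1.1 (by simp)) (mul_nonneg hn hδ))
    rw [Z_apply]
    refine (M.nrm_alt_le (b := numSub ι * δ * (numSub ι * (η * M.nrm f))) (by positivity)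
      fun U hU => ?_).trans (le_of_eq (by ring))
    rw [Finset.empty_union, ← M.A_A_of_subset (T := univ.erase i) fun j hj => by
      simp only [Finset.mem_erase, Finset.mem_univ, and_true]; rintro rfl; exact hi1.2 (hU hj)]
    exact (M.nrm_A_le _ _).trans key
  · have hinv : M.A (S₁ ∪ S₂) (M.lowComp d f S₁ * M.lowComp d f S₂) =
        M.lowComp d f S₁ * M.lowComp d f S₂ :=
      M.A_mul_of_inv (A_lowComp Finset.subset_union_left) (A_lowComp Finset.subset_union_right)
    rw [← hinv]
    refine (hM.nrm_Z_A_le hη hT _).trans ?_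
    have := (M.nrm_mul_le (g := M.lowComp d f S₂) (mul_nonneg hn hδ)
      (hf.abs_lowComp_le hδ S₁)).trans
      (mul_le_mul_of_nonneg_left (nrm_lowComp_le S₂) (mul_nonneg hn hδ))
    calc _ ≤ numSub ι * (η * (numSub ι * δ * (numSub ι * M.nrm f))) := by gcongr
      _ = _ := by ring

/-- The part of `(f^{≤d})²` built from the pairs of components `(P ∪ E, Q ∪ E)`. -/
noncomputable def pairSum (M : CondSystem ι Ω) (d : ℕ) (f : Ω → ℝ) (P Q : Finset ι) : Ω → ℝ :=
  ∑ E ∈ (P ∪ Q)ᶜ.powerset, M.lowComp d f (P ∪ E) * M.lowComp d f (Q ∪ E)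

lemma Global.nrm_Z_sq_le (hf : M.Global d δ f) (hM : M.AlmostCommute η) (hη : 0 ≤ η)
    (hδ : 0 ≤ δ) (T : Finset ι) :
    M.nrm (M.Z ∅ T ((∑ S, M.lowComp d f S) * ∑ S, M.lowComp d f S)) ^ 2 ≤
      11 / 10 * ∑ p : Finset ι × Finset ι with p.1 ∪ p.2 = T,
        3 ^ (p.1 ∪ p.2).card * M.nrm (M.Z ∅ (p.1 ∪ p.2) (M.pairSum d f p.1 p.2)) ^ 2 +
      11 * (numSub ι ^ 10 * η ^ 2 * δ ^ 2 * M.nrm f ^ 2) := by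
  have hn : 0 ≤ numSub ι := numSub_nonneg
  have hnf := M.nrm_nonneg f
  have hb : 0 ≤ numSub ι ^ 3 * η * δ * M.nrm f := by positivity
  have hsplit : M.Z ∅ T ((∑ S, M.lowComp d f S) * ∑ S, M.lowComp d f S) =
      (∑ p : Finset ι × Finset ι with p.1 ∪ p.2 = T, M.Z ∅ T (M.pairSum d f p.1 p.2)) +
      ∑ p : Finset ι × Finset ι with ¬ (p.1 \ T = p.2 \ T ∧ T ⊆ p.1 ∪ p.2),
        M.Z ∅ T (M.lowComp d f p.1 * M.lowComp d f p.2) := by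
    unfold pairSum
    rw [Finset.sum_mul_sum, ← Finset.sum_product', Finset.univ_product_univ, ← map_sum,
      ← sum_pairs_eq T fun S₁ S₂ => M.lowComp d f S₁ * M.lowComp d f S₂, ← map_sum, ← map_add,
      Finset.sum_filter_add_sum_filter_not]
  have hbad : M.nrm (∑ p : Finset ι × Finset ι with ¬ (p.1 \ T = p.2 \ T ∧ T ⊆ p.1 ∪ p.2),
        M.Z ∅ T (M.lowComp d f p.1 * M.lowComp d f p.2)) ≤
      numSub ι ^ 5 * η * δ * M.nrm f := by
    refine (M.nrm_sum_le _ _).trans ((Finset.sum_le_card_nsmul _ _ _ fun p hp =>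
      hf.nrm_Z_mul_le hM hη hδ (Finset.mem_filter.1 hp).2).trans ?_)
    rw [nsmul_eq_mul]
    have hc : ((univ.filter fun p : Finset ι × Finset ι =>
        ¬ (p.1 \ T = p.2 \ T ∧ T ⊆ p.1 ∪ p.2)).card : ℝ) ≤ numSub ι ^ 2 := by
      refine (Nat.cast_le.2 (Finset.card_le_univ _)).trans (le_of_eq ?_)
      rw [Fintype.card_prod, Nat.cast_mul, sq, numSub]
    exact (mul_le_mul_of_nonneg_right hc hb).trans (le_of_eq (by ring))
  rw [hsplit]
  refine (M.nrm_add_sq_le _ _).trans ?_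
  have h2 := pow_le_pow_left₀ (M.nrm_nonneg _) hbad 2
  have h3 : (numSub ι ^ 5 * η * δ * M.nrm f) ^ 2 =
    numSub ι ^ 10 * η ^ 2 * δ ^ 2 * M.nrm f ^ 2 := by ring
  rw [h3] at h2
  refine add_le_add (mul_le_mul_of_nonneg_left ?_ (by norm_num))
    (mul_le_mul_of_nonneg_left h2 (by norm_num))
  refine (M.nrm_sum_sq_le _ _).trans ?_
  rw [Finset.mul_sum]
  refine Finset.sum_le_sum fun p hp => ?_
  rw [(Finset.mem_filter.1 hp).2]
  exact mul_le_mul_of_nonneg_right (card_pairs_union_eq_le T) (sq_nonneg _)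

end CondSystem

section SubsetSums

variable {ι : Type*} [Fintype ι] [DecidableEq ι]

lemma sum_compl_powerset_union {E' : Type*} [AddCommMonoid E'] (P : Finset ι)
    (φ : Finset ι → E') :
    ∑ E ∈ Pᶜ.powerset, φ (P ∪ E) = ∑ S : Finset ι with P ⊆ S, φ S := by
  refine Finset.sum_bij' (fun E _ => P ∪ E) (fun S _ => S \ P) ?_ ?_ ?_ ?_ ?_
  · intro E _; simp
  · intro S _; exact Finset.mem_powerset.2 fun i hi => by simpa using (Finset.mem_sdiff.1 hi).2
  · intro E hE
    exact Finset.union_sdiff_cancel_left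
      (Finset.subset_compl_iff_disjoint_left.1 (Finset.mem_powerset.1 hE))
  · intro S hS
    exact Finset.union_sdiff_of_subset (Finset.mem_filter.1 hS).2
  · intro E _; rfl

lemma sum_three_pow_card_interval {D S : Finset ι} (h : D ⊆ S) :
    ∑ P : Finset ι with D ⊆ P ∧ P ⊆ S, (3 : ℝ) ^ (P.card - D.card) =
      4 ^ (S.card - D.card) := by
  have h1 : ∑ P : Finset ι with D ⊆ P ∧ P ⊆ S, (3 : ℝ) ^ (P.card - D.card) =
      ∑ P ∈ (S \ D).powerset, (3 : ℝ) ^ P.card * 1 ^ ((S \ D).card - P.card) := by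
    refine Finset.sum_bij' (fun P _ => P \ D) (fun P _ => D ∪ P) ?_ ?_ ?_ ?_ ?_
    · intro P hP
      exact Finset.mem_powerset.2
        (Finset.sdiff_subset_sdiff (Finset.mem_filter.1 hP).2.2 subset_rfl)
    · intro P hP
      simp only [Finset.mem_filter, Finset.mem_univ, true_and]
      exact ⟨Finset.subset_union_left, Finset.union_subset h
        ((Finset.mem_powerset.1 hP).trans Finset.sdiff_subset)⟩
    · intro P hP
      exact Finset.union_sdiff_of_subset (Finset.mem_filter.1 hP).2.1
    · intro P hP
      exact Finset.union_sdiff_cancel_left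
        (Finset.disjoint_of_subset_right (Finset.mem_powerset.1 hP) Finset.disjoint_sdiff)
    · intro P hP
      rw [one_pow, mul_one, Finset.card_sdiff_of_subset (Finset.mem_filter.1 hP).2.1]
  rw [h1, Finset.sum_pow_mul_eq_add_pow, Finset.card_sdiff_of_subset h]
  norm_num

lemma sum_three_pow_smul_eq {E' : Type*} [AddCommGroup E'] [Module ℝ E'] (D : Finset ι)
    (φ : Finset ι → E') :
    ∑ P : Finset ι with D ⊆ P, (3 : ℝ) ^ (P.card - D.card) • ∑ E ∈ Pᶜ.powerset, φ (P ∪ E) =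
      ∑ S : Finset ι with D ⊆ S, (4 : ℝ) ^ (S.card - D.card) • φ S := by
  simp only [sum_compl_powerset_union, Finset.smul_sum]
  rw [Finset.sum_comm' (t' := univ.filter fun S => D ⊆ S)
    (s' := fun S => univ.filter fun P => D ⊆ P ∧ P ⊆ S)]
  · refine Finset.sum_congr rfl fun S hS => ?_
    rw [← Finset.sum_smul, sum_three_pow_card_interval (Finset.mem_filter.1 hS).2]
  · intro P S
    simp only [Finset.mem_filter, Finset.mem_univ, true_and]
    exact ⟨fun h => ⟨h, h.1.trans h.2⟩, fun h => h.1⟩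

lemma sum_three_pow_four_pow (φ : Finset ι → ℝ) :
    ∑ D : Finset ι, (3 : ℝ) ^ D.card * ∑ S : Finset ι with D ⊆ S, 4 ^ (S.card - D.card) * φ S =
      ∑ S : Finset ι, 7 ^ S.card * φ S := by
  simp only [Finset.mul_sum]
  rw [Finset.sum_comm' (t' := univ) (s' := fun S => S.powerset) (by simp)]
  refine Finset.sum_congr rfl fun S _ => ?_
  simp only [← mul_assoc, ← Finset.sum_mul]
  rw [Finset.sum_pow_mul_eq_add_pow]
  norm_num

end SubsetSums

namespace CondSystem

variable {ι Ω : Type*} [Fintype ι] [DecidableEq ι] [Fintype Ω] {M : CondSystem ι Ω} {η δ : ℝ}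
  {d : ℕ} {f : Ω → ℝ}

lemma Global.nrm_A_pairSum_le (hf : M.Global d δ f) (hM : M.AlmostCommute η) (hη : 0 ≤ η)
    (hδ : 0 ≤ δ) (P Q : Finset ι) :
    M.nrm (M.A (P ∪ Q) (M.pairSum d f P Q)) ^ 2 ≤
      M.ip (M.A (P ∩ Q) (∑ E ∈ (P ∪ Q)ᶜ.powerset, M.lowComp d f (P ∪ E) ^ 2))
        (∑ E ∈ (P ∪ Q)ᶜ.powerset, M.lowComp d f (Q ∪ E) ^ 2) +
      2 * numSub ι ^ 4 * η * δ ^ 2 * M.energy d f := by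
  have hn : 0 ≤ numSub ι := numSub_nonneg
  set c := numSub ι * δ * √(M.energy d f) with hc
  have hc0 : 0 ≤ c := by positivity
  have hcsq : c * c = numSub ι ^ 2 * δ ^ 2 * M.energy d f := by
    have := Real.mul_self_sqrt (energy_nonneg (M := M) (d := d) (f := f))
    rw [hc]; linear_combination (numSub ι ^ 2 * δ ^ 2) * this
  have h1 : M.nrm (M.A (P ∪ Q) (M.pairSum d f P Q)) ^ 2 ≤
      M.ip (M.A (P ∪ Q) (∑ E ∈ (P ∪ Q)ᶜ.powerset, M.lowComp d f (P ∪ E) ^ 2))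
        (∑ E ∈ (P ∪ Q)ᶜ.powerset, M.lowComp d f (Q ∪ E) ^ 2) := by
    rw [nrm_sq, ← M.ip_A_A (P ∪ Q) (∑ E ∈ (P ∪ Q)ᶜ.powerset, M.lowComp d f (P ∪ E) ^ 2)
      (∑ E ∈ (P ∪ Q)ᶜ.powerset, M.lowComp d f (Q ∪ E) ^ 2)]
    refine Finset.sum_le_sum fun x _ => mul_le_mul_of_nonneg_left ?_ (M.w_nonneg x)
    rw [← sq]
    exact M.A_sum_mul_sq_le _ _ _ _ x
  have hterm : ∀ E₁ ∈ (P ∪ Q)ᶜ.powerset, ∀ E₂ ∈ (P ∪ Q)ᶜ.powerset,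
      M.ip (M.A (P ∪ Q) (M.lowComp d f (P ∪ E₁) ^ 2)) (M.lowComp d f (Q ∪ E₂) ^ 2) ≤
      M.ip (M.A (P ∩ Q) (M.lowComp d f (P ∪ E₁) ^ 2)) (M.lowComp d f (Q ∪ E₂) ^ 2) +
        2 * η * (c * c) := by
    intro E₁ hE₁ E₂ hE₂
    have hE₁' : ∀ i ∈ E₁, i ∉ P ∧ i ∉ Q := fun i hi => by
      simpa using Finset.mem_powerset.1 hE₁ hi
    have hE₂' : ∀ i ∈ E₂, i ∉ P ∧ i ∉ Q := fun i hi => by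
      simpa using Finset.mem_powerset.1 hE₂ hi
    set p := M.lowComp d f (P ∪ E₁) ^ 2
    set q := M.lowComp d f (Q ∪ E₂) ^ 2
    have hp : M.A (P ∪ E₁) p = p := A_lowComp_sq subset_rfl
    have hq : M.A (Q ∪ E₂) q = q := A_lowComp_sq subset_rfl
    have hpn : M.nrm p ≤ c := hf.nrm_lowComp_sq_le hδ _
    have hqn : M.nrm q ≤ c := hf.nrm_lowComp_sq_le hδ _
    have e1 : (P ∪ Q) ∩ (P ∪ E₁) = P := by
      ext i; simp only [Finset.mem_inter, Finset.mem_union]; have := hE₁' i; tauto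
    have e2 : (Q ∪ E₂) ∩ P = P ∩ Q := by
      ext i; simp only [Finset.mem_inter, Finset.mem_union]; have := hE₂' i; tauto
    have s1 := hM (P ∪ Q) (P ∪ E₁) p
    have s2 := hM (Q ∪ E₂) P p
    rw [e1, hp] at s1
    rw [e2] at s2
    have t1 := M.ip_le (M.A (P ∪ Q) p - M.A P p) q
    have t2 := M.ip_le (M.A (Q ∪ E₂) (M.A P p) - M.A (P ∩ Q) p) q
    rw [ip_sub_left] at t1 t2
    rw [ip_A _ (Q ∪ E₂), hq] at t2
    have u : ∀ {a : ℝ}, 0 ≤ a → a ≤ η * M.nrm p → a * M.nrm q ≤ η * (c * c) := by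
      intro a _ ha
      calc a * M.nrm q ≤ η * c * c :=
            mul_le_mul (ha.trans (mul_le_mul_of_nonneg_left hpn hη)) hqn (M.nrm_nonneg q)
              (mul_nonneg hη hc0)
        _ = _ := by ring
    have u1 := u (M.nrm_nonneg _) s1
    have u2 := u (M.nrm_nonneg _) s2
    linarith
  refine h1.trans ?_
  simp only [map_sum, ip_sum_left, ip_sum_right]
  refine (Finset.sum_le_sum fun E₂ h₂ => Finset.sum_le_sum fun E₁ h₁ => hterm E₁ h₁ E₂ h₂).trans ?_
  simp only [Finset.sum_add_distrib]
  have h0 : 0 ≤ 2 * η * (c * c) := by positivity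
  have h2 := sum_le_numSub_mul (ι := ι) (P ∪ Q)ᶜ.powerset
    (g := fun _ => ∑ _E ∈ (P ∪ Q)ᶜ.powerset, 2 * η * (c * c))
    (mul_nonneg hn h0) fun _ _ => sum_le_numSub_mul _ h0 fun _ _ => le_rfl
  have h3 : numSub ι * (numSub ι * (2 * η * (c * c))) =
      2 * numSub ι ^ 4 * η * δ ^ 2 * M.energy d f := by rw [hcsq]; ring
  linarith

/-- The weighted sum of the squared components at supersets of `D`. -/
noncomputable def influence (M : CondSystem ι Ω) (d : ℕ) (f : Ω → ℝ) (D : Finset ι) : Ω → ℝ :=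
  ∑ S : Finset ι with D ⊆ S, (4 : ℝ) ^ (S.card - D.card) • M.lowComp d f S ^ 2

lemma influence_nonneg (D : Finset ι) : 0 ≤ M.influence d f D :=
  Finset.sum_nonneg fun S _ => smul_nonneg (by positivity) fun x => sq_nonneg (M.lowComp d f S x)

lemma sum_lowComp_sq_nonneg (s : Finset (Finset ι)) (P : Finset ι) :
    0 ≤ ∑ E ∈ s, M.lowComp d f (P ∪ E) ^ 2 :=
  Finset.sum_nonneg fun E _ x => sq_nonneg (M.lowComp d f (P ∪ E) x)

lemma sum_pairs_le :
    ∑ p : Finset ι × Finset ι, 3 ^ (p.1 ∪ p.2).card *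
      M.ip (M.A (p.1 ∩ p.2) (∑ E ∈ (p.1 ∪ p.2)ᶜ.powerset, M.lowComp d f (p.1 ∪ E) ^ 2))
        (∑ E ∈ (p.1 ∪ p.2)ᶜ.powerset, M.lowComp d f (p.2 ∪ E) ^ 2) ≤
    ∑ D : Finset ι, 3 ^ D.card * M.ip (M.A D (M.influence d f D)) (M.influence d f D) := by
  rw [← Finset.sum_fiberwise univ (fun p : Finset ι × Finset ι => p.1 ∩ p.2)]
  refine Finset.sum_le_sum fun D _ => ?_
  let v : Finset ι → Ω → ℝ := fun P => ∑ E ∈ Pᶜ.powerset, M.lowComp d f (P ∪ E) ^ 2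
  have hv : ∀ P, 0 ≤ v P := fun P => sum_lowComp_sq_nonneg _ P
  have hI : M.influence d f D =
      ∑ P : Finset ι with D ⊆ P, (3 : ℝ) ^ (P.card - D.card) • v P :=
    (sum_three_pow_smul_eq D fun S => M.lowComp d f S ^ 2).symm
  have hmono : ∀ {P T : Finset ι}, P ⊆ T →
      ∑ E ∈ Tᶜ.powerset, M.lowComp d f (P ∪ E) ^ 2 ≤ v P := by
    intro P T h
    refine Finset.sum_le_sum_of_subset_of_nonneg
      (Finset.powerset_mono.2 (Finset.compl_subset_compl.2 h)) fun E _ _ x => ?_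
    exact sq_nonneg (M.lowComp d f (P ∪ E) x)
  have hR : 3 ^ D.card * M.ip (M.A D (M.influence d f D)) (M.influence d f D) =
      ∑ p ∈ (univ.filter fun P => D ⊆ P) ×ˢ (univ.filter fun P => D ⊆ P),
        3 ^ D.card * (3 ^ (p.1.card - D.card) * (3 ^ (p.2.card - D.card) *
          M.ip (M.A D (v p.1)) (v p.2))) := by
    rw [hI, Finset.sum_product, map_sum, ip_sum_left, Finset.mul_sum]
    refine Finset.sum_congr rfl fun P _ => ?_
    rw [map_smul, ip_smul_left, ip_sum_right, Finset.mul_sum, Finset.mul_sum]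
    refine Finset.sum_congr rfl fun Q _ => ?_
    rw [ip_comm, ip_smul_left, ip_comm]
  rw [hR]
  refine le_trans (Finset.sum_le_sum fun p hp => ?_) (Finset.sum_le_sum_of_subset_of_nonneg ?_ ?_)
  · obtain ⟨P, Q⟩ := p
    simp only [Finset.mem_filter, Finset.mem_univ, true_and] at hp
    subst hp
    have hcard : (P ∪ Q).card =
        (P ∩ Q).card + ((P.card - (P ∩ Q).card) + (Q.card - (P ∩ Q).card)) := by
      have h1 := Finset.card_union_add_card_inter P Q
      have h2 := Finset.card_le_card (Finset.inter_subset_left (s₁ := P) (s₂ := Q))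
      have h3 := Finset.card_le_card (Finset.inter_subset_right (s₁ := P) (s₂ := Q))
      omega
    simp only
    rw [hcard, pow_add, pow_add, mul_assoc, mul_assoc]
    gcongr
    refine (M.ip_mono_left (M.A_mono _ (hmono Finset.subset_union_left))
      (sum_lowComp_sq_nonneg _ Q)).trans ?_
    rw [ip_comm, M.ip_comm _ (v Q)]
    exact M.ip_mono_left (hmono Finset.subset_union_right) (M.A_nonneg _ _ (hv P))
  · rintro ⟨P, Q⟩ h
    simp only [Finset.mem_filter, Finset.mem_univ, true_and] at h
    subst h
    simp [Finset.inter_subset_left, Finset.inter_subset_right]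
  · intro p _ _
    have := M.ip_nonneg (M.A_nonneg D _ (hv p.1)) (hv p.2)
    positivity

/-- Approximate Bessel inequality in the links of `R`, weighted by a function of the
coordinates `R`. -/
lemma AlmostCommute.sum_ip_Z_sq_le (hM : M.AlmostCommute η) (hη : 0 ≤ η) {R : Finset ι}
    {χ : Ω → ℝ} (hχ : 0 ≤ χ) (hR : M.A R χ = χ) :
    ∑ G ∈ Rᶜ.powerset, M.ip (M.Z R G f ^ 2) χ ≤
      (1 + numSub ι ^ 4 * η) * M.ip (f ^ 2) χ := by
  set s : Ω → ℝ := Real.sqrt ∘ χ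
  have hs : M.A R s = s := M.A_comp R χ Real.sqrt hR
  have hZ : ∀ G, M.Z R G (s * f) = s * M.Z R G f := by
    intro G
    rw [Z_apply, Z_apply, alt, alt, Finset.mul_sum]
    refine Finset.sum_congr rfl fun T _ => ?_
    rw [mul_smul_comm, M.A_mul]
    conv_lhs => rw [← hs]
    rw [M.A_A_of_superset Finset.subset_union_left, hs]
  have hip : ∀ h : Ω → ℝ, M.ip (h ^ 2) χ = M.nrm (s * h) ^ 2 := by
    intro h
    rw [nrm_sq]
    refine Finset.sum_congr rfl fun x _ => ?_
    have : s x * s x = χ x := Real.mul_self_sqrt (hχ x)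
    simp only [Pi.pow_apply, Pi.mul_apply]
    rw [← this]; ring
  simp only [hip, ← hZ]
  exact hM.sum_nrm_Z_sq_le hη R (s * f)

lemma Global.nrm_Z_sq_pow_le (hf : M.Global d δ f) (hδ : 0 ≤ δ) {R G : Finset ι}
    (h : Disjoint R G) (hd : (R ∪ G).card ≤ d) :
    M.nrm (M.Z R G f ^ 2) ≤ numSub ι ^ 2 * δ * √(M.energy d f) := by
  have hn : 0 ≤ numSub ι := numSub_nonneg
  have h1 : M.nrm (M.Z R G f) ≤ numSub ι * √(M.energy d f) := by
    rw [M.Z_eq_sum h]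
    refine (M.nrm_sum_le _ _).trans (sum_le_numSub_mul _ (Real.sqrt_nonneg _) fun R' hR' => ?_)
    have hc : (R' ∪ G).card ≤ d := (Finset.card_le_card
      (Finset.union_subset_union_left (Finset.mem_powerset.1 hR'))).trans hd
    have := nrm_lowComp_le_sqrt (M := M) (d := d) (f := f) (R' ∪ G)
    rwa [lowComp, if_pos hc] at this
  rw [sq]
  refine (M.nrm_mul_le (mul_nonneg hn hδ) (hf.abs_Z_le hδ hd)).trans ?_
  calc _ ≤ numSub ι * δ * (numSub ι * √(M.energy d f)) := by gcongr
    _ = _ := by ring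

lemma Global.nrm_influence_le (hf : M.Global d δ f) (hδ : 0 ≤ δ) (D : Finset ι) :
    M.nrm (M.influence d f D) ≤ numSub ι ^ 4 * δ * √(M.energy d f) := by
  have hn : 0 ≤ numSub ι := numSub_nonneg
  have hb : 0 ≤ numSub ι ^ 3 * δ * √(M.energy d f) := by positivity
  refine (M.nrm_sum_le _ _).trans ((sum_le_numSub_mul _ hb fun S _ => ?_).trans
    (le_of_eq (by ring)))
  rw [nrm_smul, abs_of_nonneg (by positivity)]
  have h4 : (4 : ℝ) ^ (S.card - D.card) ≤ numSub ι ^ 2 :=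
    (pow_le_pow_right₀ (by norm_num) (Nat.sub_le _ _)).trans (four_pow_card_le S)
  calc _ ≤ numSub ι ^ 2 * (numSub ι * δ * √(M.energy d f)) :=
        mul_le_mul h4 (hf.nrm_lowComp_sq_le hδ S) (M.nrm_nonneg _) (by positivity)
    _ = _ := by ring

lemma ip_one_influence (D : Finset ι) : M.ip 1 (M.influence d f D) =
    ∑ S : Finset ι with D ⊆ S, 4 ^ (S.card - D.card) * M.nrm (M.lowComp d f S) ^ 2 := by
  unfold influence
  rw [ip_sum_right]
  refine Finset.sum_congr rfl fun S _ => ?_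
  rw [ip_comm, ip_smul_left, nrm_sq]
  simp [ip, sq]

lemma Global.ip_influence_le (hf : M.Global d δ f) (hM : M.AlmostCommute η) (hη : 0 ≤ η)
    (hδ : 0 ≤ δ) (D : Finset ι) :
    M.ip (M.A D (M.influence d f D)) (M.influence d f D) ≤
      4 ^ d * ((1 + numSub ι ^ 4 * η) * (δ ^ 2 * M.ip 1 (M.influence d f D)) +
        numSub ι ^ 8 * η * δ ^ 2 * M.energy d f) := by
  have hn : 0 ≤ numSub ι := numSub_nonneg
  have hΦ : 0 ≤ M.energy d f := energy_nonneg
  have hI := influence_nonneg (M := M) (d := d) (f := f) D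
  have hI1 : 0 ≤ M.ip 1 (M.influence d f D) := M.ip_nonneg (fun _ => zero_le_one) hI
  set ψ := M.A D (M.influence d f D) with hψ
  have hψ0 : 0 ≤ ψ := M.A_nonneg _ _ hI
  have hψD : M.A D ψ = ψ := M.A_idem _ _
  have hψn : M.nrm ψ ≤ numSub ι ^ 4 * δ * √(M.energy d f) :=
    (M.nrm_A_le _ _).trans (hf.nrm_influence_le hδ D)
  have hcross : ∀ R ⊆ D, ∀ S, D ⊆ S → S.card ≤ d →
      M.ip (M.Z R (S \ D) f ^ 2) ψ ≤ M.ip (M.Z R (S \ D) f ^ 2) (M.A R ψ) +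
        numSub ι ^ 6 * η * δ ^ 2 * M.energy d f := by
    intro R hR S hS hSd
    have hdis : Disjoint R (S \ D) := Finset.disjoint_of_subset_left hR Finset.disjoint_sdiff
    have hsub : R ∪ S \ D ⊆ S := Finset.union_subset (hR.trans hS) Finset.sdiff_subset
    have hzn := hf.nrm_Z_sq_pow_le hδ hdis ((Finset.card_le_card hsub).trans hSd)
    have hz : M.A (R ∪ S \ D) (M.Z R (S \ D) f ^ 2) = M.Z R (S \ D) f ^ 2 := by
      rw [sq]
      exact M.A_mul_of_inv (M.A_Z_of_subset subset_rfl f) (M.A_Z_of_subset subset_rfl f)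
    set z := M.Z R (S \ D) f ^ 2
    have e1 : (R ∪ S \ D) ∩ D = R := by
      ext i; simp only [Finset.mem_inter, Finset.mem_union, Finset.mem_sdiff]
      have := @hR i; tauto
    have s1 := hM (R ∪ S \ D) D ψ
    rw [e1, hψD] at s1
    have t1 := M.ip_le (M.A (R ∪ S \ D) ψ - M.A R ψ) z
    rw [ip_sub_left, ip_A _ (R ∪ S \ D), hz] at t1
    rw [M.ip_comm z, M.ip_comm z]
    have t2 : M.nrm (M.A (R ∪ S \ D) ψ - M.A R ψ) * M.nrm z ≤
        η * (numSub ι ^ 4 * δ * √(M.energy d f)) * (numSub ι ^ 2 * δ * √(M.energy d f)) :=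
      mul_le_mul (s1.trans (mul_le_mul_of_nonneg_left hψn hη)) hzn (M.nrm_nonneg _) (by positivity)
    have t3 : η * (numSub ι ^ 4 * δ * √(M.energy d f)) * (numSub ι ^ 2 * δ * √(M.energy d f)) =
        numSub ι ^ 6 * η * δ ^ 2 * M.energy d f := by
      linear_combination (numSub ι ^ 6 * η * δ ^ 2) * Real.mul_self_sqrt hΦ
    linarith
  have hlink : ∀ R ⊆ D, D.card ≤ d →
      ∑ S : Finset ι with D ⊆ S, M.ip (M.Z R (S \ D) f ^ 2) (M.A R ψ) ≤
        (1 + numSub ι ^ 4 * η) * (δ ^ 2 * M.ip 1 (M.influence d f D)) := by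
    intro R hR hD
    have hχ : 0 ≤ M.A R ψ := M.A_nonneg _ _ hψ0
    have h1 : ∑ S : Finset ι with D ⊆ S, M.ip (M.Z R (S \ D) f ^ 2) (M.A R ψ) =
        ∑ G ∈ Dᶜ.powerset, M.ip (M.Z R G f ^ 2) (M.A R ψ) := by
      rw [← sum_compl_powerset_union]
      refine Finset.sum_congr rfl fun G hG => ?_
      rw [Finset.union_sdiff_cancel_left
        (Finset.subset_compl_iff_disjoint_left.1 (Finset.mem_powerset.1 hG))]
    have h2 : ∑ G ∈ Dᶜ.powerset, M.ip (M.Z R G f ^ 2) (M.A R ψ) ≤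
        ∑ G ∈ Rᶜ.powerset, M.ip (M.Z R G f ^ 2) (M.A R ψ) :=
      Finset.sum_le_sum_of_subset_of_nonneg
        (Finset.powerset_mono.2 (Finset.compl_subset_compl.2 hR))
        fun G _ _ => M.ip_nonneg (fun x => sq_nonneg (M.Z R G f x)) hχ
    have h3 := hM.sum_ip_Z_sq_le (f := f) hη hχ (M.A_idem R ψ)
    have h4 : M.ip (f ^ 2) (M.A R ψ) ≤ δ ^ 2 * M.ip 1 (M.influence d f D) := by
      rw [← ip_A]
      refine (M.ip_mono_left (f' := δ ^ 2 • (1 : Ω → ℝ)) (fun x => ?_) hψ0).trans (le_of_eq ?_)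
      · simpa using hf R ((Finset.card_le_card hR).trans hD) x
      · rw [ip_smul_left, hψ, ← ip_A, M.A_one]
    rw [h1]
    exact h2.trans (h3.trans (mul_le_mul_of_nonneg_left h4 (by positivity)))
  have herr : 0 ≤ numSub ι ^ 6 * η * δ ^ 2 * M.energy d f := by positivity
  have hterm : ∀ S ∈ univ.filter fun S : Finset ι => D ⊆ S,
      4 ^ (S.card - D.card) * M.ip (M.lowComp d f S ^ 2) ψ ≤
        4 ^ (d - D.card) * (2 ^ D.card * ∑ R ∈ D.powerset,
          (M.ip (M.Z R (S \ D) f ^ 2) (M.A R ψ) + numSub ι ^ 6 * η * δ ^ 2 * M.energy d f)) := by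
    intro S hS
    have hS := (Finset.mem_filter.1 hS).2
    have hnn : ∀ R, 0 ≤ M.ip (M.Z R (S \ D) f ^ 2) (M.A R ψ) := fun R =>
      M.ip_nonneg (fun x => sq_nonneg (M.Z R (S \ D) f x)) (M.A_nonneg _ _ hψ0)
    by_cases hSd : S.card ≤ d
    · refine mul_le_mul (pow_le_pow_right₀ (by norm_num) (Nat.sub_le_sub_right hSd _)) ?_
        (M.ip_nonneg (fun x => sq_nonneg (M.lowComp d f S x)) hψ0) (by positivity)
      have hexp : M.lowComp d f S = alt (fun R => M.Z R (S \ D) f) D := by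
        rw [lowComp, if_pos hSd, ← M.Z_empty_union Finset.disjoint_sdiff,
          Finset.union_sdiff_of_subset hS]
      have hpt : M.lowComp d f S ^ 2 ≤ (2 : ℝ) ^ D.card • ∑ R ∈ D.powerset,
          M.Z R (S \ D) f ^ 2 := by
        intro x
        rw [hexp, alt]
        simp only [Pi.pow_apply, Finset.sum_apply, Pi.smul_apply, smul_eq_mul]
        refine sq_sum_le_card_mul_sum_sq.trans (le_of_eq ?_)
        rw [Finset.card_powerset]
        push_cast
        congr 1
        refine Finset.sum_congr rfl fun R _ => ?_
        rw [mul_pow, ← pow_mul, mul_comm _ 2, pow_mul]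
        simp
      refine (M.ip_mono_left hpt hψ0).trans ?_
      rw [ip_smul_left, ip_sum_left]
      gcongr with R hR
      exact hcross R (Finset.mem_powerset.1 hR) S hS hSd
    · rw [lowComp, if_neg hSd]
      have : M.ip ((0 : Ω → ℝ) ^ 2) ψ = 0 := by simp [ip]
      rw [this, mul_zero]
      exact mul_nonneg (by positivity) (mul_nonneg (by positivity)
        (Finset.sum_nonneg fun R _ => add_nonneg (hnn R) herr))
  have hexpand : M.ip ψ (M.influence d f D) =
      ∑ S : Finset ι with D ⊆ S, 4 ^ (S.card - D.card) * M.ip (M.lowComp d f S ^ 2) ψ := by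
    unfold influence
    rw [ip_comm, ip_sum_left]
    exact Finset.sum_congr rfl fun S _ => M.ip_smul_left _ _ _
  by_cases hD : D.card ≤ d
  · rw [hexpand]
    refine (Finset.sum_le_sum hterm).trans ?_
    rw [← Finset.mul_sum, ← Finset.mul_sum, Finset.sum_comm]
    have hR : ∀ R ∈ D.powerset, ∑ S : Finset ι with D ⊆ S,
        (M.ip (M.Z R (S \ D) f ^ 2) (M.A R ψ) + numSub ι ^ 6 * η * δ ^ 2 * M.energy d f) ≤
        (1 + numSub ι ^ 4 * η) * (δ ^ 2 * M.ip 1 (M.influence d f D)) +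
          numSub ι * (numSub ι ^ 6 * η * δ ^ 2 * M.energy d f) := by
      intro R hR
      rw [Finset.sum_add_distrib]
      exact add_le_add (hlink R (Finset.mem_powerset.1 hR) hD)
        (sum_le_numSub_mul _ herr fun _ _ => le_rfl)
    have hsum := Finset.sum_le_card_nsmul _ _ _ hR
    rw [Finset.card_powerset, nsmul_eq_mul] at hsum
    push_cast at hsum
    have h4 : (4 : ℝ) ^ (d - D.card) * (2 ^ D.card * 2 ^ D.card) = 4 ^ d := by
      rw [← mul_pow, ← pow_sub_mul_pow (4 : ℝ) hD]; norm_num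
    have hn8 : numSub ι ^ 7 * (η * δ ^ 2 * M.energy d f) ≤
        numSub ι ^ 8 * (η * δ ^ 2 * M.energy d f) :=
      mul_le_mul_of_nonneg_right (pow_le_pow_right₀ one_le_numSub (by norm_num)) (by positivity)
    calc _ ≤ 4 ^ (d - D.card) * (2 ^ D.card * (2 ^ D.card *
          ((1 + numSub ι ^ 4 * η) * (δ ^ 2 * M.ip 1 (M.influence d f D)) +
          numSub ι * (numSub ι ^ 6 * η * δ ^ 2 * M.energy d f)))) := by gcongr
      _ = 4 ^ d * ((1 + numSub ι ^ 4 * η) * (δ ^ 2 * M.ip 1 (M.influence d f D)) +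
          numSub ι ^ 7 * (η * δ ^ 2 * M.energy d f)) := by rw [← h4]; ring
      _ ≤ _ :=
        mul_le_mul_of_nonneg_left (add_le_add le_rfl (hn8.trans_eq (by ring))) (by positivity)
  · have hz : M.ip ψ (M.influence d f D) = 0 := by
      rw [hexpand]
      refine Finset.sum_eq_zero fun S hS => ?_
      rw [lowComp, if_neg fun h => hD ((Finset.card_le_card (Finset.mem_filter.1 hS).2).trans h)]
      simp [ip]
    rw [hz]
    positivity

/-- Bonami-type inequality for global functions on almost product spaces. -/
theorem Global.fourth_moment_le (hf : M.Global d δ f) (hM : M.AlmostCommute η) (hη : 0 ≤ η)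
    (hδ : 0 ≤ δ) (hη' : numSub ι ^ 11 * η ≤ 1 / 100) :
    M.nrm ((∑ S, M.lowComp d f S) * ∑ S, M.lowComp d f S) ^ 2 ≤
      7 / 5 * 28 ^ d * δ ^ 2 * M.nrm (∑ S, M.lowComp d f S) ^ 2 +
        (14 * 28 ^ d * numSub ι ^ 7 + 12 * numSub ι ^ 11) * η ^ 2 * δ ^ 2 * M.nrm f ^ 2 := by
  have hn : 0 ≤ numSub ι := numSub_nonneg
  have hΦ0 : 0 ≤ M.energy d f := energy_nonneg
  have hη4 : numSub ι ^ 4 * η ≤ 1 / 100 := (mul_le_mul_of_nonneg_right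
    (pow_le_pow_right₀ one_le_numSub (by norm_num)) hη).trans hη'
  have hη8 : numSub ι ^ 8 * η ≤ 1 / 100 := (mul_le_mul_of_nonneg_right
    (pow_le_pow_right₀ one_le_numSub (by norm_num)) hη).trans hη'
  have hE := hM.energy_le (d := d) (f := f) hη
  set g := ∑ S, M.lowComp d f S with hg
  set Φ := M.energy d f with hΦ
  set X := M.nrm (g * g) ^ 2 with hX
  have hX0 : 0 ≤ X := sq_nonneg _
  have hmain : ∑ p : Finset ι × Finset ι, 3 ^ (p.1 ∪ p.2).card *
      M.nrm (M.Z ∅ (p.1 ∪ p.2) (M.pairSum d f p.1 p.2)) ^ 2 ≤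
      101 / 100 * (104 / 100 * 28 ^ d * (δ ^ 2 * Φ)) := by
    have h1 : ∑ p : Finset ι × Finset ι, 3 ^ (p.1 ∪ p.2).card *
        (2 * numSub ι ^ 4 * η * δ ^ 2 * Φ) ≤ 2 * (numSub ι ^ 8 * η) * (δ ^ 2 * Φ) := by
      have hb : 0 ≤ 2 * numSub ι ^ 4 * η * δ ^ 2 * Φ := by positivity
      refine (Finset.sum_le_card_nsmul _ _ (numSub ι ^ 2 * (2 * numSub ι ^ 4 * η * δ ^ 2 * Φ))
        fun p _ => mul_le_mul_of_nonneg_right (three_pow_card_le _) hb).trans (le_of_eq ?_)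
      rw [Finset.card_univ, Fintype.card_prod, nsmul_eq_mul, Nat.cast_mul, numSub]
      ring
    have h2 : ∑ D : Finset ι, 3 ^ D.card *
        M.ip (M.A D (M.influence d f D)) (M.influence d f D) ≤
        4 ^ d * ((1 + numSub ι ^ 4 * η) * (δ ^ 2 * (7 ^ d * Φ)) +
          numSub ι ^ 11 * η * (δ ^ 2 * Φ)) := by
      calc _ ≤ ∑ D : Finset ι, 3 ^ D.card * (4 ^ d * ((1 + numSub ι ^ 4 * η) *
            (δ ^ 2 * M.ip 1 (M.influence d f D)) + numSub ι ^ 8 * η * δ ^ 2 * Φ)) := by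
            gcongr with D
            exact hf.ip_influence_le hM hη hδ D
        _ = 4 ^ d * ((1 + numSub ι ^ 4 * η) * (δ ^ 2 *
              ∑ D : Finset ι, 3 ^ D.card * M.ip 1 (M.influence d f D)) +
              ∑ D : Finset ι, 3 ^ D.card * (numSub ι ^ 8 * η * δ ^ 2 * Φ)) := by
            simp only [Finset.mul_sum, ← Finset.sum_add_distrib]
            exact Finset.sum_congr rfl fun D _ => by ring
        _ ≤ _ := by
            have h3 : ∑ D : Finset ι, 3 ^ D.card * M.ip 1 (M.influence d f D) ≤ 7 ^ d * Φ := by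
              simp only [ip_one_influence]
              rw [sum_three_pow_four_pow, hΦ, energy, Finset.mul_sum]
              refine Finset.sum_le_sum fun S _ => ?_
              by_cases hS : S.card ≤ d
              · gcongr
                norm_num
              · rw [lowComp, if_neg hS, nrm_zero]; simp
            have h4 : ∑ D : Finset ι, 3 ^ D.card * (numSub ι ^ 8 * η * δ ^ 2 * Φ) ≤
                numSub ι ^ 11 * η * (δ ^ 2 * Φ) := by
              have hb : 0 ≤ numSub ι ^ 8 * η * δ ^ 2 * Φ := by positivity
              refine (sum_le_numSub_mul _ (mul_nonneg (pow_nonneg hn 2) hb) fun D _ =>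
                mul_le_mul_of_nonneg_right (three_pow_card_le D) hb).trans (le_of_eq (by ring))
            gcongr
    have h28 : (28 : ℝ) ^ d = 4 ^ d * 7 ^ d := by rw [← mul_pow]; norm_num
    have h428 : (4 : ℝ) ^ d ≤ 28 ^ d := by gcongr; norm_num
    have h128 : (1 : ℝ) ≤ 28 ^ d := one_le_pow₀ (by norm_num)
    have hq : 0 ≤ δ ^ 2 * Φ := by positivity
    calc _ ≤ ∑ p : Finset ι × Finset ι, 3 ^ (p.1 ∪ p.2).card * ((1 + numSub ι ^ 4 * η) *
          (M.ip (M.A (p.1 ∩ p.2) (∑ E ∈ (p.1 ∪ p.2)ᶜ.powerset, M.lowComp d f (p.1 ∪ E) ^ 2))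
            (∑ E ∈ (p.1 ∪ p.2)ᶜ.powerset, M.lowComp d f (p.2 ∪ E) ^ 2) +
            2 * numSub ι ^ 4 * η * δ ^ 2 * Φ)) := by
          gcongr with p
          exact (hM.nrm_Z_empty_sq_le hη _ _).trans (mul_le_mul_of_nonneg_left
            (hf.nrm_A_pairSum_le hM hη hδ p.1 p.2) (by positivity))
      _ = (1 + numSub ι ^ 4 * η) * (∑ p : Finset ι × Finset ι, 3 ^ (p.1 ∪ p.2).card *
          M.ip (M.A (p.1 ∩ p.2) (∑ E ∈ (p.1 ∪ p.2)ᶜ.powerset, M.lowComp d f (p.1 ∪ E) ^ 2))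
            (∑ E ∈ (p.1 ∪ p.2)ᶜ.powerset, M.lowComp d f (p.2 ∪ E) ^ 2) +
          ∑ p : Finset ι × Finset ι, 3 ^ (p.1 ∪ p.2).card *
            (2 * numSub ι ^ 4 * η * δ ^ 2 * Φ)) := by
          rw [← Finset.sum_add_distrib, Finset.mul_sum]
          exact Finset.sum_congr rfl fun p _ => by ring
      _ ≤ (1 + numSub ι ^ 4 * η) * (4 ^ d * ((1 + numSub ι ^ 4 * η) * (δ ^ 2 * (7 ^ d * Φ)) +
          numSub ι ^ 11 * η * (δ ^ 2 * Φ)) + 2 * (numSub ι ^ 8 * η) * (δ ^ 2 * Φ)) := by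
          gcongr
          exact sum_pairs_le.trans h2
      _ ≤ 101 / 100 * (4 ^ d * (101 / 100 * (δ ^ 2 * (7 ^ d * Φ)) +
          1 / 100 * (δ ^ 2 * Φ)) + 2 * (1 / 100) * (δ ^ 2 * Φ)) := by
          gcongr
          · linarith
          · linarith
      _ ≤ _ := by
          rw [h28]
          rw [h28] at h428 h128
          have e1 := mul_le_mul_of_nonneg_right h428 hq
          have e2 := mul_le_mul_of_nonneg_right h128 hq
          nlinarith
  have hXle : X ≤ 11 / 10 * (101 / 100 * (104 / 100 * 28 ^ d * (δ ^ 2 * Φ))) +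
      11 * numSub ι ^ 11 * η ^ 2 * δ ^ 2 * M.nrm f ^ 2 + 1 / 100 * X := by
    have hnf := M.nrm_nonneg f
    have h1 : ∑ T, M.nrm (M.Z ∅ T (g * g)) ^ 2 ≤
        11 / 10 * (101 / 100 * (104 / 100 * 28 ^ d * (δ ^ 2 * Φ))) +
        numSub ι * (11 * (numSub ι ^ 10 * η ^ 2 * δ ^ 2 * M.nrm f ^ 2)) := by
      refine (Finset.sum_le_sum fun T _ => hf.nrm_Z_sq_le hM hη hδ T).trans ?_
      rw [Finset.sum_add_distrib, ← Finset.mul_sum,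
        Finset.sum_fiberwise univ (fun p : Finset ι × Finset ι => p.1 ∪ p.2)]
      gcongr
      exact sum_le_numSub_mul _ (by positivity) fun _ _ => le_rfl
    have h2 := hM.nrm_sq_le hη (g * g)
    have h3 := mul_le_mul_of_nonneg_right hη4 hX0
    rw [← hX] at h2
    linarith
  have hE' : Φ ≤ 1111 / 1000 * M.nrm g ^ 2 + 11 * numSub ι ^ 7 * η ^ 2 * M.nrm f ^ 2 := by
    have := mul_le_mul_of_nonneg_right hη4 (sq_nonneg (M.nrm g))
    linarith
  have hc : (0 : ℝ) ≤ 28 ^ d * δ ^ 2 := by positivity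
  have h5 := mul_le_mul_of_nonneg_left hE' hc
  have h6 : 0 ≤ numSub ι ^ 11 * η ^ 2 * δ ^ 2 * M.nrm f ^ 2 := by positivity
  have h7 : 0 ≤ 28 ^ d * δ ^ 2 * (numSub ι ^ 7 * η ^ 2 * M.nrm f ^ 2) := by positivity
  have h8 : 0 ≤ 28 ^ d * δ ^ 2 * M.nrm g ^ 2 := by positivity
  nlinarith

end CondSystem

namespace CondSystem

variable {ι Ω : Type*} [Fintype ι] [DecidableEq ι] [Fintype Ω] {M : CondSystem ι Ω} {ε : ℝ}

lemma nrm_A_A_sub_le_of_link {S T U : Finset ι} (hT : S ⊆ T) (hU : S ⊆ U)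
    (H : ∀ p q, M.A T p = p → M.A U q = q → ∀ x,
      |M.A S (p * q) x - M.A S p x * M.A S q x| ≤ ε * (√(M.A S (p ^ 2) x) * √(M.A S (q ^ 2) x)))
    (hε : 0 ≤ ε) (f : Ω → ℝ) : M.nrm (M.A T (M.A U f) - M.A S f) ≤ ε * M.nrm f := by
  have hSq : M.A S (M.A U f) = M.A S f := M.A_A_of_subset hU f
  have hUq : M.A U (M.A U f) = M.A U f := M.A_idem U f
  have hqf : M.nrm (M.A U f) ≤ M.nrm f := M.nrm_A_le U f
  rw [← hSq]
  generalize M.A U f = q at *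
  set p := M.A T q - M.A S q with hp
  have hTp : M.A T p = p := by rw [hp, map_sub, M.A_idem, M.A_A_of_superset hT]
  have hSp : M.A S p = 0 := by rw [hp, map_sub, M.A_A_of_subset hT, M.A_idem, sub_self]
  have hsqrt : ∀ g, M.nrm (Real.sqrt ∘ M.A S (g ^ 2)) = M.nrm g := by
    intro g
    have h0 : 0 ≤ M.A S (g ^ 2) := M.A_nonneg _ _ fun x => sq_nonneg (g x)
    have h1 : M.ip (Real.sqrt ∘ M.A S (g ^ 2)) (Real.sqrt ∘ M.A S (g ^ 2)) =
        M.ip (M.A S (g ^ 2)) 1 := by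
      refine Finset.sum_congr rfl fun x _ => ?_
      rw [Function.comp_apply, Real.mul_self_sqrt (h0 x), Pi.one_apply, mul_one]
    rw [nrm, nrm, h1, ip_A, M.A_one]
    congr 1
    refine Finset.sum_congr rfl fun x _ => ?_
    rw [Pi.one_apply, mul_one, Pi.pow_apply, sq]
  have hpq : M.ip p q ≤ ε * (M.nrm p * M.nrm q) := by
    calc M.ip p q = M.ip 1 (M.A S (p * q)) := by
          rw [← M.ip_A S 1, M.A_one]
          exact Finset.sum_congr rfl fun x _ => by simp
      _ ≤ ε * M.ip (Real.sqrt ∘ M.A S (p ^ 2)) (Real.sqrt ∘ M.A S (q ^ 2)) := by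
          unfold ip
          rw [Finset.mul_sum]
          refine Finset.sum_le_sum fun x _ => ?_
          have h := H p q hTp hUq x
          rw [hSp, Pi.zero_apply, zero_mul, sub_zero] at h
          rw [Pi.one_apply, one_mul, mul_left_comm]
          exact mul_le_mul_of_nonneg_left ((le_abs_self _).trans h) (M.w_nonneg x)
      _ ≤ _ := by
          refine mul_le_mul_of_nonneg_left ((M.ip_le _ _).trans_eq ?_) hε
          rw [hsqrt, hsqrt]
  have hpp : M.nrm p ^ 2 = M.ip p q := by
    rw [nrm_sq]
    conv_lhs => rw [M.ip_comm]; arg 2; rw [hp]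
    rw [ip_sub_left, M.ip_A T, M.ip_A S, hTp, hSp, M.ip_comm]
    simp [ip]
  rcases (M.nrm_nonneg p).eq_or_lt with h0 | h0
  · rw [← h0]; exact mul_nonneg hε (M.nrm_nonneg f)
  · refine le_of_mul_le_mul_left ?_ h0
    calc M.nrm p * M.nrm p ≤ ε * (M.nrm p * M.nrm q) := by rw [← sq, hpp]; exact hpq
      _ = M.nrm p * (ε * M.nrm q) := by ring
      _ ≤ _ := by gcongr

lemma almostCommute_of_insert (hε : 0 ≤ ε)
    (H : ∀ (S : Finset ι) (i j : ι), i ∉ S → j ∉ S → i ≠ j → ∀ f,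
      M.nrm (M.A (insert i S) (M.A (insert j S) f) - M.A S f) ≤ ε * M.nrm f) :
    M.AlmostCommute (Fintype.card ι ^ 2 * ε) := by
  have h1 : ∀ (R Q : Finset ι) (i : ι), i ∉ R → i ∉ Q → Disjoint R Q → ∀ f,
      M.nrm (M.A (insert i R) (M.A (R ∪ Q) f) - M.A R f) ≤ Q.card * ε * M.nrm f := by
    intro R Q i hiR hiQ hd f
    induction Q using Finset.induction_on with
    | empty =>
      rw [Finset.union_empty, M.A_A_of_superset (Finset.subset_insert i R), sub_self, nrm_zero]
      simp
    | insert j Q hj ih =>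
      simp only [Finset.mem_insert, not_or] at hiQ
      rw [Finset.disjoint_insert_right] at hd
      have hs : insert i R ⊆ insert i (R ∪ Q) :=
        Finset.insert_subset_insert i Finset.subset_union_left
      have e : M.A (insert i R) (M.A (R ∪ insert j Q) f) - M.A R f =
          M.A (insert i R) (M.A (insert i (R ∪ Q)) (M.A (insert j (R ∪ Q)) f) - M.A (R ∪ Q) f) +
          (M.A (insert i R) (M.A (R ∪ Q) f) - M.A R f) := by
        rw [map_sub, M.A_A_of_subset hs, Finset.union_insert]; abel
      rw [e, Finset.card_insert_of_notMem hj]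
      refine (M.nrm_add_le _ _).trans ?_
      have t1 := (M.nrm_A_le (insert i R) _).trans
        (H (R ∪ Q) i j (by simp [hiR, hiQ.2]) (by simp [hd.1, hj]) hiQ.1 f)
      have t2 := ih hiQ.2 hd.2
      push_cast
      linarith
  have h2 : ∀ (R P Q : Finset ι), Disjoint R P → Disjoint R Q → Disjoint P Q → ∀ f,
      M.nrm (M.A (R ∪ P) (M.A (R ∪ Q) f) - M.A R f) ≤ P.card * (Q.card * ε * M.nrm f) := by
    intro R P Q hRP hRQ hPQ f
    induction P using Finset.induction_on with
    | empty =>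
      rw [Finset.union_empty, M.A_A_of_subset Finset.subset_union_left, sub_self, nrm_zero]
      simp
    | insert i P hi ih =>
      rw [Finset.disjoint_insert_right] at hRP
      rw [Finset.disjoint_insert_left] at hPQ
      have t1 := h1 (R ∪ P) Q i (by simp [hRP.1, hi]) hPQ.1
        (Finset.disjoint_union_left.2 ⟨hRQ, hPQ.2⟩) (M.A (R ∪ Q) f)
      rw [M.A_A_of_superset (Finset.union_subset_union_left Finset.subset_union_left)] at t1
      have t2 := ih hRP.2 hPQ.2
      have t3 : Q.card * ε * M.nrm (M.A (R ∪ Q) f) ≤ Q.card * ε * M.nrm f :=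
        mul_le_mul_of_nonneg_left (M.nrm_A_le _ f) (by positivity)
      rw [Finset.union_insert, Finset.card_insert_of_notMem hi,
        ← sub_add_sub_cancel _ (M.A (R ∪ P) (M.A (R ∪ Q) f))]
      refine (M.nrm_add_le _ _).trans ?_
      push_cast
      linarith
  intro T U f
  have h := h2 (T ∩ U) (T \ U) (U \ T) (Finset.disjoint_sdiff_inter T U).symm
    (by rw [Finset.inter_comm]; exact (Finset.disjoint_sdiff_inter U T).symm)
    (Finset.disjoint_of_subset_right Finset.sdiff_subset Finset.sdiff_disjoint) f
  rw [Finset.union_comm, Finset.sdiff_union_inter, Finset.union_comm, Finset.inter_comm,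
    Finset.sdiff_union_inter, Finset.inter_comm] at h
  refine h.trans ?_
  have c1 : ((T \ U).card : ℝ) ≤ Fintype.card ι := by exact_mod_cast Finset.card_le_univ _
  have c2 : ((U \ T).card : ℝ) ≤ Fintype.card ι := by exact_mod_cast Finset.card_le_univ _
  have := M.nrm_nonneg f
  calc _ ≤ (Fintype.card ι : ℝ) * (Fintype.card ι * ε * M.nrm f) := by gcongr
    _ = _ := by ring

end CondSystem

lemma sum_support {Ω : Type*} [Fintype Ω] {w g : Ω → ℝ} (h : ∀ z, ¬ 0 < w z → g z = 0) :
    ∑ z : {z // 0 < w z}, g z = ∑ z, g z := by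
  refine Fintype.sum_of_injective Subtype.val Subtype.val_injective _ g (fun z hz => h z ?_)
    fun _ => rfl
  simpa using hz

section Links

variable {μ : (∀ i, V i) → ℝ} {S T : Finset (Fin k)} {x y z : ∀ i, V i}

lemma marg_pos (h0 : ∀ x, 0 ≤ μ x) (hx : 0 < μ x) : 0 < marg μ S x := by
  refine Finset.sum_pos' (fun z _ => ?_) ⟨x, Finset.mem_univ x, by simpa using hx⟩
  split_ifs
  exacts [h0 z, le_rfl]

lemma marg_congr (h : ∀ i ∈ S, x i = y i) : marg μ S x = marg μ S y :=
  Finset.sum_congr rfl fun z _ => if_congr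
    (forall₂_congr fun i hi => by rw [h i hi]) rfl rfl

lemma cond_congr (h : ∀ i ∈ S, x i = y i) : cond μ S x z = cond μ S y z := by
  unfold cond
  rw [marg_congr h]
  exact if_congr (forall₂_congr fun i hi => by rw [h i hi]) rfl rfl

lemma cond_nonneg (h0 : ∀ x, 0 ≤ μ x) : 0 ≤ cond μ S x z := by
  unfold cond
  split_ifs
  · refine div_nonneg (h0 z) (Finset.sum_nonneg fun y _ => ?_)
    split_ifs
    exacts [h0 y, le_rfl]
  · exact le_rfl

lemma cond_eq_zero_of_not_agree (h : ¬ ∀ i ∈ S, z i = x i) : cond μ S x z = 0 := if_neg h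

lemma cond_eq_zero_of_not_pos (h0 : ∀ x, 0 ≤ μ x) (h : ¬ 0 < μ z) : cond μ S x z = 0 := by
  unfold cond
  rw [le_antisymm (not_lt.1 h) (h0 z)]
  simp

lemma sum_cond (h : 0 < marg μ S x) : ∑ z, cond μ S x z = 1 := by
  rw [← div_self h.ne']
  conv_rhs => arg 1; unfold marg
  rw [Finset.sum_div]
  exact Finset.sum_congr rfl fun z _ => by unfold cond; split_ifs <;> simp

lemma mul_cond_comm (x z : ∀ i, V i) : μ x * cond μ S x z = μ z * cond μ S z x := by
  unfold cond
  by_cases h : ∀ i ∈ S, z i = x i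
  · rw [if_pos h, if_pos fun i hi => (h i hi).symm, marg_congr h]; ring
  · rw [if_neg h, if_neg fun h' => h fun i hi => (h' i hi).symm, mul_zero, mul_zero]

lemma cond_mul_cond (h : S ⊆ T) (x y z : ∀ i, V i) :
    cond μ S x z * cond μ T z y = cond μ S x y * cond μ T y z := by
  unfold cond
  by_cases h1 : ∀ i ∈ T, y i = z i
  · have h2 : (∀ i ∈ S, z i = x i) ↔ ∀ i ∈ S, y i = x i :=
      forall₂_congr fun i hi => by rw [h1 i (h hi)]
    rw [if_pos h1, if_pos fun i hi => (h1 i hi).symm, marg_congr h1]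
    simp only [h2]
    split_ifs <;> ring
  · rw [if_neg h1, if_neg (c := ∀ i ∈ T, z i = y i) fun h' => h1 fun i hi => (h' i hi).symm,
      mul_zero, mul_zero]

/-- Averaging over the coordinates outside `S`, on functions defined on the support of `μ`. -/
noncomputable def linkAvg (μ : (∀ i, V i) → ℝ) (S : Finset (Fin k)) :
    ({x // 0 < μ x} → ℝ) →ₗ[ℝ] ({x // 0 < μ x} → ℝ) where
  toFun f x := ∑ z : {z // 0 < μ z}, cond μ S x z * f z
  map_add' f g := by
    ext x
    simp only [Pi.add_apply, mul_add, Finset.sum_add_distrib]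
  map_smul' c f := by
    ext x
    simp only [Pi.smul_apply, smul_eq_mul, RingHom.id_apply, Finset.mul_sum, mul_left_comm]

lemma linkAvg_apply (f : {x // 0 < μ x} → ℝ) (x : {x // 0 < μ x}) :
    linkAvg μ S f x = ∑ z : {z // 0 < μ z}, cond μ S x z * f z := rfl

lemma linkAvg_restrict (h0 : ∀ x, 0 ≤ μ x) (f : (∀ i, V i) → ℝ) (x : {x // 0 < μ x}) :
    linkAvg μ S (fun z => f z) x = ∑ z, cond μ S x z * f z :=
  sum_support (g := fun z => cond μ S x z * f z) fun z hz => by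
    rw [cond_eq_zero_of_not_pos h0 hz, zero_mul]

lemma linkAvg_congr (f : {x // 0 < μ x} → ℝ) {x y : {x // 0 < μ x}}
    (h : ∀ i ∈ S, x.1 i = y.1 i) : linkAvg μ S f x = linkAvg μ S f y := by
  simp only [linkAvg_apply, cond_congr h]

lemma linkAvg_one (h0 : ∀ x, 0 ≤ μ x) : linkAvg μ S 1 = 1 := by
  ext x
  have := linkAvg_restrict (S := S) h0 (fun _ => 1) x
  simp only [mul_one] at this
  rw [sum_cond (marg_pos h0 x.2)] at this
  exact this

lemma linkAvg_mul {f : {x // 0 < μ x} → ℝ}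
    (hf : ∀ x y : {x // 0 < μ x}, (∀ i ∈ S, x.1 i = y.1 i) → f x = f y)
    (g : {x // 0 < μ x} → ℝ) : linkAvg μ S (f * g) = f * linkAvg μ S g := by
  ext x
  simp only [linkAvg_apply, Pi.mul_apply, Finset.mul_sum]
  refine Finset.sum_congr rfl fun z _ => ?_
  by_cases h : ∀ i ∈ S, z.1 i = x.1 i
  · rw [hf z x h]; ring
  · rw [cond_eq_zero_of_not_agree h]; ring

lemma linkAvg_eq_self_iff (h0 : ∀ x, 0 ≤ μ x) {f : {x // 0 < μ x} → ℝ} :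
    linkAvg μ S f = f ↔ ∀ x y : {x // 0 < μ x}, (∀ i ∈ S, x.1 i = y.1 i) → f x = f y := by
  refine ⟨fun hf x y h => ?_, fun hf => ?_⟩
  · rw [← hf]; exact linkAvg_congr f h
  · have := linkAvg_mul hf 1
    rwa [mul_one, linkAvg_one h0, mul_one] at this

/-- The conditional expectations of a finite probability measure on a product. -/
noncomputable def linkSystem (h0 : ∀ x, 0 ≤ μ x) : CondSystem (Fin k) {x // 0 < μ x} where
  w x := μ x
  w_nonneg x := h0 x
  A := linkAvg μ
  A_univ f := (linkAvg_eq_self_iff h0).2 fun x y h => by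
    rw [Subtype.ext (funext fun i => h i (Finset.mem_univ i))]
  A_A_of_subset {S T} h f := by
    ext x
    simp only [linkAvg_apply, Finset.mul_sum, ← mul_assoc]
    rw [Finset.sum_comm]
    refine Finset.sum_congr rfl fun y _ => ?_
    rw [← Finset.sum_mul, Finset.sum_congr rfl fun z _ => cond_mul_cond h x.1 y.1 z.1,
      ← Finset.mul_sum]
    have := congrFun (linkAvg_one (S := T) h0) y
    simp only [linkAvg_apply, Pi.one_apply, mul_one] at this
    rw [this, mul_one]
  A_A_of_superset h f := (linkAvg_eq_self_iff h0).2 fun x y hxy =>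
    linkAvg_congr f fun i hi => hxy i (h hi)
  A_symm S f g := by
    simp only [linkAvg_apply, Finset.sum_mul, Finset.mul_sum]
    rw [Finset.sum_comm]
    refine Finset.sum_congr rfl fun x _ => Finset.sum_congr rfl fun z _ => ?_
    linear_combination (f x * g z) * mul_cond_comm (μ := μ) (S := S) z.1 x.1
  A_nonneg S f hf x := Finset.sum_nonneg fun z _ => mul_nonneg (cond_nonneg h0) (hf z)
  A_one S := linkAvg_one h0
  A_mul S f g hf := linkAvg_mul ((linkAvg_eq_self_iff h0).1 hf) g
  A_comp S f φ hf := (linkAvg_eq_self_iff h0).2 fun x y h =>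
    congrArg φ ((linkAvg_eq_self_iff h0).1 hf x y h)

end Links

section EpsProduct

variable {μ : (∀ i, V i) → ℝ} {ε δ : ℝ} {d : ℕ}

lemma exists_eq_on_link {S : Finset (Fin k)} {i : Fin k} {q : {x // 0 < μ x} → ℝ}
    (hq : ∀ x y : {x // 0 < μ x}, (∀ l ∈ insert i S, x.1 l = y.1 l) → q x = q y)
    (x : ∀ i, V i) :
    ∃ g : V i → ℝ, ∀ z : {x // 0 < μ x}, (∀ l ∈ S, z.1 l = x l) → g (z.1 i) = q z := by
  classical
  refine ⟨fun a => if h : ∃ z : {x // 0 < μ x}, (∀ l ∈ S, z.1 l = x l) ∧ z.1 i = a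
    then q h.choose else 0, fun z hz => ?_⟩
  have h : ∃ z' : {x // 0 < μ x}, (∀ l ∈ S, z'.1 l = x l) ∧ z'.1 i = z.1 i := ⟨z, hz, rfl⟩
  refine (dif_pos h).trans (hq _ _ fun l hl => ?_)
  rcases Finset.mem_insert.1 hl with rfl | hl
  · exact h.choose_spec.2
  · rw [h.choose_spec.1 l hl, hz l hl]

lemma expect_cond_eq (h0 : ∀ x, 0 ≤ μ x) {S : Finset (Fin k)} {g : (∀ i, V i) → ℝ}
    {q : {x // 0 < μ x} → ℝ} {x : {x // 0 < μ x}}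
    (h : ∀ z : {x // 0 < μ x}, (∀ l ∈ S, z.1 l = x.1 l) → g z = q z) :
    expect (cond μ S x) g = (linkSystem h0).A S q x := by
  rw [expect, ← linkAvg_restrict h0 g x]
  refine Finset.sum_congr rfl fun z _ => ?_
  by_cases hz : ∀ l ∈ S, z.1 l = x.1 l
  · simp only [h z hz]
  · rw [cond_eq_zero_of_not_agree hz, zero_mul, zero_mul]

lemma EpsProduct.almostCommute (h0 : ∀ x, 0 ≤ μ x) (hμ : EpsProduct μ ε) (hε : 0 ≤ ε) :
    (linkSystem h0).AlmostCommute (k ^ 2 * ε) := by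
  have := CondSystem.almostCommute_of_insert (M := linkSystem h0) hε fun S i j hi hj hij =>
    CondSystem.nrm_A_A_sub_le_of_link (Finset.subset_insert i S) (Finset.subset_insert j S)
      (fun p q hp hq x => ?_) hε
  · rwa [Fintype.card_fin] at this
  have hS : S.card ≤ k - 2 := by
    have h := Finset.card_le_univ (insert i (insert j S))
    rw [Finset.card_insert_of_notMem (by simp [hij, hi]), Finset.card_insert_of_notMem hj,
      Fintype.card_fin] at h
    omega
  obtain ⟨a, ha⟩ := exists_eq_on_link ((linkAvg_eq_self_iff h0).1 hp) x.1
  obtain ⟨b, hb⟩ := exists_eq_on_link ((linkAvg_eq_self_iff h0).1 hq) x.1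
  have h := hμ S hS x (marg_pos h0 x.2) i j hi hj hij a b
  rw [expect_cond_eq h0 (q := p * q) fun z hz => by rw [ha z hz, hb z hz, Pi.mul_apply],
    expect_cond_eq h0 ha, expect_cond_eq h0 hb,
    expect_cond_eq h0 (q := p ^ 2) fun z hz => by rw [ha z hz, Pi.pow_apply],
    expect_cond_eq h0 (q := q ^ 2) fun z hz => by rw [hb z hz, Pi.pow_apply]] at h
  have hA := fun g : {x // 0 < μ x} → ℝ =>
    (linkSystem h0).A_nonneg S (g ^ 2) (fun x => sq_nonneg (g x)) x
  refine h.trans (mul_le_mul_of_nonneg_left ?_ hε)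
  rw [← Real.sqrt_mul (hA p)]
  refine Real.sqrt_le_sqrt (mul_le_mul (sub_le_self _ (sq_nonneg _)) (sub_le_self _ (sq_nonneg _))
    (sub_nonneg.2 ((linkSystem h0).A_sq_le S q x)) (hA p))

lemma IsGlobal.global (h0 : ∀ x, 0 ≤ μ x) {f : (∀ i, V i) → ℝ} (hf : IsGlobal μ d δ f)
    (hδ : 0 ≤ δ) : (linkSystem h0).Global d δ fun z => f z := by
  intro R hR x
  have h := (Real.sqrt_le_left hδ).1 (hf R hR x (marg_pos h0 x.2))
  rwa [← linkAvg_restrict h0 (fun z => f z ^ 2)] at h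

lemma lowPart_eq (h0 : ∀ x, 0 ≤ μ x) (f : (∀ i, V i) → ℝ) (x : {x // 0 < μ x}) :
    lowPart μ d f x = (∑ S, (linkSystem h0).lowComp d (fun z => f z) S) x := by
  rw [Finset.sum_apply, lowPart, Finset.powerset_univ, Finset.sum_filter]
  refine Finset.sum_congr rfl fun S _ => ?_
  unfold CondSystem.lowComp
  split_ifs
  · rw [CondSystem.Z_apply, alt, Finset.sum_apply]
    refine Finset.sum_congr rfl fun T hT => ?_
    rw [Finset.empty_union, Pi.smul_apply, smul_eq_mul]
    exact congrArg _ (linkAvg_restrict h0 f x).symm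
  · rfl

lemma normSq_eq (h0 : ∀ x, 0 ≤ μ x) (f : (∀ i, V i) → ℝ) :
    normSq μ f = (linkSystem h0).nrm (fun z => f z) ^ 2 := by
  rw [CondSystem.nrm_sq, normSq, ← sum_support (w := μ) fun z hz => by
    rw [le_antisymm (not_lt.1 hz) (h0 z), zero_mul]]
  exact Finset.sum_congr rfl fun z _ => by rw [sq]; rfl

lemma norm4p4_eq (h0 : ∀ x, 0 ≤ μ x) (f : (∀ i, V i) → ℝ) :
    norm4p4 μ f =
      (linkSystem h0).nrm ((fun z : {x // 0 < μ x} => f z) * fun z : {x // 0 < μ x} => f z) ^ 2 := by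
  refine Eq.trans ?_ (normSq_eq h0 (f * f))
  exact Finset.sum_congr rfl fun x _ => by rw [Pi.mul_apply]; ring

end EpsProduct

theorem statement19 (k : ℕ) (hk : 1 ≤ k) :
    ∃ ε₀ C : ℝ, 0 < ε₀ ∧ 0 < C ∧
      ∀ (V : Fin k → Type) [∀ i, Fintype (V i)] [∀ i, DecidableEq (V i)]
        (μ : (∀ i, V i) → ℝ) (ε δ : ℝ) (d : ℕ) (f : (∀ i, V i) → ℝ),
        0 < ε → ε ≤ ε₀ → IsProb μ → EpsProduct μ ε → d ≤ k → 0 < δ →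
        IsGlobal μ d δ f →
        norm4p4 μ (lowPart μ d f) ≤
          (100 * (d : ℝ)) ^ d * δ ^ 2 * normSq μ (lowPart μ d f) +
            C * δ ^ 2 * ε ^ 2 * normSq μ f := by
  set n := CondSystem.numSub (Fin k)
  have hn : 0 < n := zero_lt_one.trans_le CondSystem.one_le_numSub
  have hk0 : (0 : ℝ) < k := by exact_mod_cast hk
  refine ⟨1 / (100 * n ^ 11 * k ^ 2), (14 * 28 ^ k * n ^ 7 + 12 * n ^ 11) * k ^ 4,
    by positivity, by positivity, ?_⟩
  intro V _ _ μ ε δ d f hε hε₀ hμ hprod hd hδ hf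
  have h0 := hμ.1
  have hlow : (fun x : {x // 0 < μ x} => lowPart μ d f x) =
      ∑ S, (linkSystem h0).lowComp d (fun z => f z) S := funext (lowPart_eq h0 f)
  have hglob := hf.global h0 hδ.le
  rw [norm4p4_eq h0, normSq_eq h0 (lowPart μ d f), normSq_eq h0 f]
  rcases Nat.eq_zero_or_pos d with rfl | hd0
  · have hpt : ∀ x : {x // 0 < μ x}, |lowPart μ 0 f x| ≤ δ := by
      intro x
      have h : lowPart μ 0 f x = (linkSystem h0).A ∅ (fun z => f z) x := by
        rw [lowPart_eq h0, Finset.sum_apply, Finset.sum_eq_single ∅]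
        · simp [CondSystem.lowComp, CondSystem.Z_apply, alt]
        · intro S _ hS
          simp [CondSystem.lowComp, hS]
        · simp
      rw [h]
      exact hglob.abs_A_le hδ.le (by simp) x
    have h1 := (linkSystem h0).nrm_mul_le (g := fun x => lowPart μ 0 f x) hδ.le hpt
    have h2 := pow_le_pow_left₀ ((linkSystem h0).nrm_nonneg _) h1 2
    rw [mul_pow] at h2
    have h3 : 0 ≤ (14 * 28 ^ k * n ^ 7 + 12 * n ^ 11) * k ^ 4 *
        (δ ^ 2 * ε ^ 2 * (linkSystem h0).nrm (fun z => f z) ^ 2) := by positivity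
    rw [pow_zero, one_mul]
    linarith
  · rw [hlow]
    have hη : n ^ 11 * (k ^ 2 * ε) ≤ 1 / 100 := by
      rw [le_div_iff₀ (by positivity)] at hε₀ ⊢
      linarith
    have key := hglob.fourth_moment_le (hprod.almostCommute h0 hε.le) (by positivity) hδ.le hη
    refine key.trans (add_le_add ?_ ?_)
    · have hd1 : (1 : ℝ) ≤ d := by exact_mod_cast hd0
      have h1 : (7 / 5 : ℝ) * 28 ^ d ≤ (100 * (d : ℝ)) ^ d := by
        calc (7 / 5 : ℝ) * 28 ^ d ≤ (7 / 5) ^ d * 28 ^ d := by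
              gcongr; exact le_self_pow₀ (by norm_num) hd0.ne'
          _ = (7 / 5 * 28) ^ d := (mul_pow _ _ _).symm
          _ ≤ _ := pow_le_pow_left₀ (by norm_num) (by linarith) d
      gcongr
    · have h1 : (28 : ℝ) ^ d ≤ 28 ^ k := pow_le_pow_right₀ (by norm_num) hd
      calc _ = (14 * 28 ^ d * n ^ 7 + 12 * n ^ 11) * k ^ 4 *
            (δ ^ 2 * ε ^ 2 * (linkSystem h0).nrm (fun z => f z) ^ 2) := by ring
        _ ≤ (14 * 28 ^ k * n ^ 7 + 12 * n ^ 11) * k ^ 4 *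
            (δ ^ 2 * ε ^ 2 * (linkSystem h0).nrm (fun z => f z) ^ 2) := by gcongr
        _ = _ := by ring
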